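/- There exists a unique probability measure μ on the set of isomorphism classes of finite R-modules such that for every finite R-module M_0, the expected number of R-module surjections from a μ-random module onto M_0 equals 1, i.e., Σ_M μ(M)·#Surj_R(M, M_0) = 1. Moreover, μ is supported precisely on the finite R-modules of projective dimension 1, and for such M one has μ(M) = c/#Aut_R(M), where c = ∏_j ∏_{i=1}^∞ (1 − |k_j|^{−i}) and the outer product runs over the finitely many residue fields k_j of R. -/

import Mathlib

/- STATEMENT 17: Let ℓ be an odd prime, q a prime power, and P(x) ∈ ℤ_ℓ[x] a monic
   polynomial with ℓ ∤ P(q).  Let R = ℤ_ℓ[x]/(P(x)).  There exists a unique probability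
   measure μ on the set of isomorphism classes of finite R-modules such that for every
   finite R-module M₀ the expected number of R-module surjections from a μ-random module
   onto M₀ equals 1.  Moreover, μ is supported precisely on the finite R-modules of
   projective dimension 1, and for such M one has μ(M) = c/#Aut_R(M), where
   c = ∏_j ∏_{i=1}^∞ (1 − |k_j|^{−i}), the outer product running over the (finitely
   many) residue fields k_j of R, i.e. over the maximal ideals of R.

   The set of isomorphism classes of finite R-modules is expressed by a complete
   irredundant family of representatives. -/

open IsLocalRing

/-- The number of `R`-module automorphisms of `M`. -/
noncomputable def numAut (R M : Type) [CommRing R] [AddCommGroup M] [Module R M] : ℕ :=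
  Nat.card (M ≃ₗ[R] M)

/-- The number of `R`-module surjections from `M` onto `M'`. -/
noncomputable def numSurj (R M M' : Type) [CommRing R] [AddCommGroup M] [Module R M]
    [AddCommGroup M'] [Module R M'] : ℕ :=
  Nat.card {f : M →ₗ[R] M' // Function.Surjective f}

/-- `M` admits a projective resolution `0 → P₁ → P₀ → M → 0` of length 1. -/
def HasProjDimLEOne (R M : Type) [CommRing R] [AddCommGroup M] [Module R M] : Prop :=
  ∃ (P₀ P₁ : ModuleCat.{0} R) (f : P₁ →ₗ[R] P₀) (g : P₀ →ₗ[R] M),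
    Module.Projective R P₀ ∧ Module.Projective R P₁ ∧
    Function.Injective f ∧ Function.Surjective g ∧ LinearMap.range f = LinearMap.ker g

/-- `c = ∏_j ∏_{i=1}^∞ (1 − |k_j|^{−i})`, the outer product over the residue fields
`k_j = R/m_j` of `R` (i.e. over the maximal ideals of `R`). -/
noncomputable def cProd (R : Type) [CommRing R] : ℝ :=
  ∏ᶠ m : MaximalSpectrum R,
    ∏' i : ℕ, (1 - ((Nat.card (R ⧸ m.asIdeal) : ℝ))⁻¹ ^ (i + 1))

/-- `μ` is a probability measure on the isomorphism classes (indexed by `ι` via the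
representatives `Mod`) all of whose surjection moments equal 1. -/
def IsCLMeasure (R : Type) [CommRing R] (ι : Type) (Mod : ι → ModuleCat.{0} R)
    (μ : ι → ℝ) : Prop :=
  (∀ i, 0 ≤ μ i) ∧ HasSum μ 1 ∧
  ∀ (M₀ : Type) [AddCommGroup M₀] [Module R M₀], Finite M₀ →
    HasSum (fun i => μ i * (numSurj R (Mod i) M₀ : ℝ)) 1


set_option linter.style.haveILetI false
set_option linter.unusedSectionVars false

section P1
variable {ℓ : ℕ} [Fact ℓ.Prime] {R : Type} [CommRing R] [Algebra ℤ_[ℓ] R]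
  [Module.Finite ℤ_[ℓ] R]

/-- the submodule `a V` -/
def elSub {R : Type} [CommRing R] (a : R) (V : Type) [AddCommGroup V] [Module R V] :
    Submodule R V := LinearMap.range (LinearMap.lsmul R V a)

lemma mem_elSub {R : Type} [CommRing R] {a : R} {V : Type} [AddCommGroup V] [Module R V] {x : V} :
    x ∈ elSub a V ↔ ∃ y, a • y = x := by
  simp [elSub]

lemma ell_mem (ℓ : ℕ) [Fact ℓ.Prime] [Algebra ℤ_[ℓ] R] [Module.Finite ℤ_[ℓ] R]
    (m : Ideal R) [m.IsMaximal] : (ℓ : R) ∈ m := by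
  have : (m.comap (algebraMap ℤ_[ℓ] R)).IsMaximal :=
    Ideal.isMaximal_comap_of_isIntegral_of_isMaximal m
  have h := IsLocalRing.eq_maximalIdeal this
  have h2 : (ℓ : ℤ_[ℓ]) ∈ m.comap (algebraMap ℤ_[ℓ] R) := by
    rw [h, PadicInt.maximalIdeal_eq_span_p]
    exact Ideal.mem_span_singleton_self _
  simpa using h2

lemma ell_jac (ℓ : ℕ) [Fact ℓ.Prime] [Algebra ℤ_[ℓ] R] [Module.Finite ℤ_[ℓ] R] :
    (ℓ : R) ∈ Ideal.jacobson (⊥ : Ideal R) := by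
  rw [Ideal.jacobson, Ideal.mem_sInf]
  rintro I ⟨-, hI⟩
  exact ell_mem ℓ I

lemma ell_smul (ℓ : ℕ) [Fact ℓ.Prime] [Algebra ℤ_[ℓ] R]
    {V : Type} [AddCommGroup V] [Module R V] [Module ℤ_[ℓ] V] [IsScalarTower ℤ_[ℓ] R V]
    (k : ℕ) (x : V) : (ℓ : ℤ_[ℓ]) ^ k • x = (ℓ : R) ^ k • x := by
  rw [← algebraMap_smul R ((ℓ : ℤ_[ℓ]) ^ k) x]; simp

lemma finite_quot (ℓ : ℕ) [Fact ℓ.Prime] [Algebra ℤ_[ℓ] R] [Module.Finite ℤ_[ℓ] R]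
    (V : Type) [AddCommGroup V] [Module R V] [Module.Finite R V] (k : ℕ) :
    Finite (V ⧸ elSub ((ℓ : R) ^ k) V) := by
  let Q := V ⧸ elSub ((ℓ : R) ^ k) V
  letI : Module ℤ_[ℓ] Q := Module.compHom Q (algebraMap ℤ_[ℓ] R)
  haveI : IsScalarTower ℤ_[ℓ] R Q := ⟨fun a b c => by
    rw [Algebra.smul_def, mul_smul]; rfl⟩
  haveI : Module.Finite ℤ_[ℓ] Q := Module.Finite.trans R Q
  have hk : Module.IsTorsionBySet ℤ_[ℓ] Q (Ideal.span {(ℓ : ℤ_[ℓ]) ^ k} : Ideal ℤ_[ℓ]) := by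
    rw [← Module.isTorsionBySet_iff_is_torsion_by_span, Module.isTorsionBySet_singleton_iff]
    intro x
    rw [ell_smul (R := R)]
    obtain ⟨y, rfl⟩ := Submodule.mkQ_surjective _ x
    rw [← map_smul]
    exact (Submodule.Quotient.mk_eq_zero _).2 (mem_elSub.2 ⟨y, rfl⟩)
  letI := hk.module
  haveI : Finite (ℤ_[ℓ] ⧸ Ideal.span {(ℓ : ℤ_[ℓ]) ^ k}) := by
    have e : (ℤ_[ℓ] ⧸ Ideal.span {(ℓ : ℤ_[ℓ]) ^ k}) ≃+* ZMod (ℓ ^ k) := by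
      rw [← PadicInt.ker_toZModPow]
      exact RingHom.quotientKerEquivOfSurjective (ZMod.ringHom_surjective _)
    haveI : NeZero (ℓ ^ k) := ⟨pow_ne_zero _ (Fact.out : ℓ.Prime).ne_zero⟩
    exact Finite.of_equiv _ e.symm.toEquiv
  haveI : IsScalarTower ℤ_[ℓ] (ℤ_[ℓ] ⧸ Ideal.span {(ℓ : ℤ_[ℓ]) ^ k}) Q := hk.isScalarTower
  haveI : Module.Finite (ℤ_[ℓ] ⧸ Ideal.span {(ℓ : ℤ_[ℓ]) ^ k}) Q :=
    Module.Finite.of_restrictScalars_finite ℤ_[ℓ] _ _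
  exact Module.finite_of_finite (ℤ_[ℓ] ⧸ Ideal.span {(ℓ : ℤ_[ℓ]) ^ k})

lemma finite_residue (ℓ : ℕ) [Fact ℓ.Prime] [Algebra ℤ_[ℓ] R] [Module.Finite ℤ_[ℓ] R]
    (m : Ideal R) [m.IsMaximal] : Finite (R ⧸ m) := by
  haveI := finite_quot ℓ (R := R) R 1
  have hle : elSub ((ℓ : R) ^ 1) R ≤ m := by
    intro x hx
    obtain ⟨y, rfl⟩ := mem_elSub.1 hx
    simpa using m.mul_mem_right y (ell_mem ℓ m)
  exact Finite.of_surjective (Submodule.factor hle) (Submodule.factor_surjective hle)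

lemma finite_maxspec (ℓ : ℕ) [Fact ℓ.Prime] [Algebra ℤ_[ℓ] R] [Module.Finite ℤ_[ℓ] R] :
    Finite (MaximalSpectrum R) := by
  haveI := finite_quot ℓ (R := R) R 1
  refine Finite.of_injective (β := Set (R ⧸ elSub ((ℓ : R) ^ 1) R))
    (fun m => (elSub ((ℓ : R) ^ 1) R).mkQ '' (m.asIdeal : Set R)) ?_
  have key : ∀ m n : MaximalSpectrum R, (elSub ((ℓ : R) ^ 1) R).mkQ '' (m.asIdeal : Set R) =
      (elSub ((ℓ : R) ^ 1) R).mkQ '' (n.asIdeal : Set R) → m.asIdeal ≤ n.asIdeal := by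
    intro m n h x hx
    have : (elSub ((ℓ : R) ^ 1) R).mkQ x ∈ (elSub ((ℓ : R) ^ 1) R).mkQ '' (n.asIdeal : Set R) := by
      rw [← h]; exact ⟨x, hx, rfl⟩
    obtain ⟨y, hy, hxy⟩ := this
    have h2 := (Submodule.Quotient.eq _).1 hxy
    obtain ⟨z, hz⟩ := mem_elSub.1 h2
    haveI := n.isMaximal
    have h3 : y - x ∈ n.asIdeal := by
      rw [← hz]; simpa using n.asIdeal.mul_mem_right z (ell_mem ℓ n.asIdeal)
    have := n.asIdeal.sub_mem hy h3
    simpa using this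
  intro m n h
  exact MaximalSpectrum.ext (le_antisymm (key m n h) (key n m h.symm))

lemma ell_kill (ℓ : ℕ) [Fact ℓ.Prime] [Algebra ℤ_[ℓ] R] [Module.Finite ℤ_[ℓ] R]
    (M : Type) [AddCommGroup M] [Module R M] [Finite M] :
    ∃ k, ∀ k' ≥ k, ∀ x : M, (ℓ : R) ^ k' • x = 0 := by
  obtain ⟨a, b, hab, he⟩ := Finite.exists_ne_map_eq_of_infinite
    (fun k : ℕ => elSub ((ℓ : R) ^ k) M)
  wlog hlt : a < b generalizing a b
  · exact this b a hab.symm he.symm (by omega)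
  have hle : elSub ((ℓ : R) ^ a) M ≤ ⊥ := by
    apply Submodule.le_of_le_smul_of_le_jacobson_bot (I := Ideal.span {(ℓ : R)})
      (Module.Finite.fg_top (R := R) (M := (elSub ((ℓ : R) ^ a) M)) |> fun _ => Submodule.FG.of_finite)
    · rw [Ideal.span_singleton_le_iff_mem]; exact ell_jac ℓ
    · rw [bot_sup_eq]
      intro x hx
      have hx' : x ∈ elSub ((ℓ : R) ^ b) M := by
        have : elSub ((ℓ : R) ^ a) M = elSub ((ℓ : R) ^ b) M := he
        rwa [← this]
      obtain ⟨y, rfl⟩ := mem_elSub.1 hx'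
      obtain ⟨c, rfl⟩ := Nat.exists_eq_add_of_lt hlt
      rw [show (ℓ : R) ^ (a + c + 1) = ℓ * (ℓ ^ a * ℓ ^ c) by ring, mul_smul]
      apply Submodule.smul_mem_smul (Ideal.mem_span_singleton_self _)
      rw [mul_smul]
      exact mem_elSub.2 ⟨_, rfl⟩
  refine ⟨a, fun k' hk' x => ?_⟩
  obtain ⟨c, rfl⟩ := Nat.exists_eq_add_of_le hk'
  rw [pow_add, mul_comm, mul_smul]
  have : (ℓ : R) ^ a • x ∈ elSub ((ℓ : R) ^ a) M := mem_elSub.2 ⟨x, rfl⟩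
  rw [(Submodule.mem_bot R).1 (hle this), smul_zero]

lemma ell_reg (ℓ : ℕ) [Fact ℓ.Prime] [Algebra ℤ_[ℓ] R] [Module.Free ℤ_[ℓ] R] (k : ℕ) (x : R)
    (h : (ℓ : R) ^ k * x = 0) : x = 0 := by
  have h2 : (ℓ : ℤ_[ℓ]) ^ k • x = 0 := by rw [ell_smul (R := R)]; simpa using h
  rcases smul_eq_zero.1 h2 with h3 | h3
  · exact absurd h3 (pow_ne_zero _ (by exact_mod_cast (Fact.out : ℓ.Prime).ne_zero))
  · exact h3

lemma noeth (ℓ : ℕ) [Fact ℓ.Prime] [Algebra ℤ_[ℓ] R] [Module.Finite ℤ_[ℓ] R] :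
    IsNoetherianRing R := IsNoetherianRing.of_finite ℤ_[ℓ] R

lemma residue_card (ℓ : ℕ) [Fact ℓ.Prime] [Algebra ℤ_[ℓ] R] [Module.Finite ℤ_[ℓ] R]
    (m : Ideal R) [m.IsMaximal] : 2 ≤ Nat.card (R ⧸ m) := by
  haveI := finite_residue ℓ m
  haveI : Nontrivial (R ⧸ m) := Ideal.Quotient.nontrivial_iff.2 (Ideal.IsMaximal.ne_top ‹_›)
  exact Finite.one_lt_card

end P1


section P2
variable {R : Type} [CommRing R]

lemma exists_char {M : Type} [AddCommGroup M] [Module R M] [Module.Finite R M]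
    (W : Submodule R M) (hW : W ≠ ⊤) :
    ∃ (m : MaximalSpectrum R) (χ : M →ₗ[R] R ⧸ m.asIdeal), χ ≠ 0 ∧ W ≤ LinearMap.ker χ := by
  obtain ⟨W', hW', hle⟩ := (eq_top_or_exists_le_coatom W).resolve_left hW
  have hs : IsSimpleModule R (M ⧸ W') := isSimpleModule_iff_isCoatom.2 hW'
  obtain ⟨I, hI, ⟨e⟩⟩ := isSimpleModule_iff_quot_maximal.1 hs
  refine ⟨⟨I, hI⟩, e.toLinearMap ∘ₗ W'.mkQ, ?_, ?_⟩
  · intro h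
    apply hW'.1
    rw [eq_top_iff]
    intro x _
    have := LinearMap.congr_fun h x
    simp only [LinearMap.comp_apply, LinearMap.zero_apply] at this
    have h2 := e.map_eq_zero_iff.1 this
    simpa using h2
  · intro x hx
    simpa using hle hx

lemma exists_lift_surj {A B C : Type} [AddCommGroup A] [Module R A] [AddCommGroup B] [Module R B]
    [AddCommGroup C] [Module R C] (p : A →ₗ[R] B) (hp : Function.Surjective p) (q : A →ₗ[R] C)
    (h : ∀ x, p x = 0 → q x = 0) : ∃ F : B →ₗ[R] C, ∀ x, F (p x) = q x := by
  refine ⟨(LinearMap.ker p).liftQ q (fun x hx => h x hx) ∘ₗ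
    (p.quotKerEquivOfSurjective hp).symm.toLinearMap, fun x => ?_⟩
  have : (p.quotKerEquivOfSurjective hp).symm (p x) = Submodule.Quotient.mk x := by
    rw [LinearEquiv.symm_apply_eq]; simp
  rw [LinearMap.comp_apply, LinearEquiv.coe_coe, this]
  exact Submodule.liftQ_apply _ _ _

section ext
variable {M M₀ V S : Type} [AddCommGroup M] [Module R M] [AddCommGroup M₀] [Module R M₀]
  [AddCommGroup V] [Module R V] [AddCommGroup S] [Module R S]

/-- the graph submodule -/
def extSub (π : V →ₗ[R] M₀) (ψ : LinearMap.ker π →ₗ[R] S) : Submodule R (V × S) :=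
  LinearMap.range (LinearMap.prod (LinearMap.ker π).subtype (-ψ))

/-- pushout extension -/
abbrev ExtMod (π : V →ₗ[R] M₀) (ψ : LinearMap.ker π →ₗ[R] S) : Type := (V × S) ⧸ extSub π ψ

/-- projection of the pushout extension -/
def extG (π : V →ₗ[R] M₀) (ψ : LinearMap.ker π →ₗ[R] S) : ExtMod π ψ →ₗ[R] M₀ :=
  (extSub π ψ).liftQ (π ∘ₗ LinearMap.fst R V S) (by
    rintro _ ⟨x, rfl⟩
    simp)

/-- inclusion of `S` -/
def extS (π : V →ₗ[R] M₀) (ψ : LinearMap.ker π →ₗ[R] S) : S →ₗ[R] ExtMod π ψ :=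
  (extSub π ψ).mkQ ∘ₗ LinearMap.inr R V S

/-- map from `V` -/
def extV (π : V →ₗ[R] M₀) (ψ : LinearMap.ker π →ₗ[R] S) : V →ₗ[R] ExtMod π ψ :=
  (extSub π ψ).mkQ ∘ₗ LinearMap.inl R V S

lemma extG_S (π : V →ₗ[R] M₀) (ψ : LinearMap.ker π →ₗ[R] S) (s : S) :
    extG π ψ (extS π ψ s) = 0 := by simp [extG, extS]

lemma extG_V (π : V →ₗ[R] M₀) (ψ : LinearMap.ker π →ₗ[R] S) (v : V) :
    extG π ψ (extV π ψ v) = π v := by simp [extG, extV]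

lemma ext_decomp (π : V →ₗ[R] M₀) (ψ : LinearMap.ker π →ₗ[R] S) (x : ExtMod π ψ) :
    ∃ v s, x = extV π ψ v + extS π ψ s := by
  obtain ⟨⟨v, s⟩, rfl⟩ := Submodule.mkQ_surjective _ x
  refine ⟨v, s, ?_⟩
  simp only [extV, extS, LinearMap.comp_apply, ← map_add]
  simp

lemma extS_inj (π : V →ₗ[R] M₀) (ψ : LinearMap.ker π →ₗ[R] S) :
    Function.Injective (extS π ψ) := by
  rw [injective_iff_map_eq_zero]
  intro s hs
  have := (Submodule.Quotient.mk_eq_zero (extSub π ψ)).1 hs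
  obtain ⟨x, hx⟩ := this
  simp only [LinearMap.prod_apply, Function.prod, LinearMap.inr_apply, Prod.mk.injEq] at hx
  have hx0 : x = 0 := by ext; simpa using hx.1
  rw [← hx.2, hx0]; simp

lemma extV_ker (π : V →ₗ[R] M₀) (ψ : LinearMap.ker π →ₗ[R] S) (x : LinearMap.ker π) :
    extV π ψ x = extS π ψ (ψ x) := by
  rw [← sub_eq_zero]
  simp only [extV, extS, LinearMap.comp_apply, ← map_sub]
  exact (Submodule.Quotient.mk_eq_zero (extSub π ψ)).2 ⟨x, by simp⟩

lemma extG_ker (π : V →ₗ[R] M₀) (ψ : LinearMap.ker π →ₗ[R] S) (x : ExtMod π ψ)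
    (hx : extG π ψ x = 0) : ∃ s, x = extS π ψ s := by
  obtain ⟨v, s, rfl⟩ := ext_decomp π ψ x
  rw [map_add, extG_S, extG_V, add_zero] at hx
  refine ⟨ψ ⟨v, hx⟩ + s, ?_⟩
  rw [map_add, ← extV_ker]

lemma exists_S_lift {A : Type} [AddCommGroup A] [Module R A]
    (π : V →ₗ[R] M₀) (ψ : LinearMap.ker π →ₗ[R] S) (q : A →ₗ[R] ExtMod π ψ)
    (h : ∀ a, extG π ψ (q a) = 0) : ∃ s : A →ₗ[R] S, ∀ a, q a = extS π ψ (s a) := by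
  choose s hs using fun a => extG_ker π ψ (q a) (h a)
  refine ⟨⟨⟨s, fun a b => ?_⟩, fun r a => ?_⟩, hs⟩
  · apply extS_inj π ψ; rw [map_add, ← hs, ← hs, ← hs, map_add]
  · apply extS_inj π ψ; rw [RingHom.id_apply, map_smul, ← hs, ← hs, map_smul]

lemma ext_card_fiber (π : V →ₗ[R] M₀) (hπ : Function.Surjective π)
    (ψ : LinearMap.ker π →ₗ[R] S)
    (f : M →ₗ[R] M₀) (φ : V →ₗ[R] M) (hφ : ∀ v, f (φ v) = π v) :
    Nat.card {F : M →ₗ[R] ExtMod π ψ // Function.Surjective F ∧ (extG π ψ) ∘ₗ F = f} =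
    Nat.card {p : (LinearMap.ker f →ₗ[R] S) × (V →ₗ[R] S) // Function.Surjective p.1 ∧
      ∀ x : LinearMap.ker π, p.1 ⟨φ x, by simp [hφ]⟩ + p.2 x = ψ x} := by
  have hdec : ∀ x : M, ∃ v, ∃ y : LinearMap.ker f, x = φ v + y := by
    intro x
    obtain ⟨v, hv⟩ := hπ (f x)
    exact ⟨v, ⟨x - φ v, by simp [hφ, hv]⟩, by simp⟩
  have h1 : ∀ F : {F : M →ₗ[R] ExtMod π ψ // Function.Surjective F ∧ (extG π ψ) ∘ₗ F = f},
      ∃ p : {p : (LinearMap.ker f →ₗ[R] S) × (V →ₗ[R] S) // Function.Surjective p.1 ∧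
      ∀ x : LinearMap.ker π, p.1 ⟨φ x, by simp [hφ]⟩ + p.2 x = ψ x},
      (∀ y : LinearMap.ker f, F.1 (y : M) = extS π ψ (p.1.1 y)) ∧
      (∀ v, F.1 (φ v) = extV π ψ v - extS π ψ (p.1.2 v)) := by
    rintro ⟨F, hF, hg⟩
    have hg' : ∀ x, extG π ψ (F x) = f x := fun x => LinearMap.congr_fun hg x
    obtain ⟨s, hs⟩ := exists_S_lift π ψ (F ∘ₗ (LinearMap.ker f).subtype) (by
      intro a; simp [hg'])
    obtain ⟨η, hη⟩ := exists_S_lift π ψ (extV π ψ - F ∘ₗ φ) (by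
      intro a; simp [hg', extG_V, hφ])
    simp only [LinearMap.comp_apply, Submodule.subtype_apply] at hs
    have hη' : ∀ v, F (φ v) = extV π ψ v - extS π ψ (η v) := by
      intro v; rw [← hη]; simp
    refine ⟨⟨(s, η), ?_, ?_⟩, hs, hη'⟩
    · intro t
      obtain ⟨x, hx⟩ := hF (extS π ψ t)
      have hxk : x ∈ LinearMap.ker f := by
        rw [LinearMap.mem_ker, ← hg', hx, extG_S]
      exact ⟨⟨x, hxk⟩, extS_inj π ψ (by rw [← hs]; exact hx)⟩
    · intro x
      apply extS_inj π ψ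
      rw [map_add, ← extV_ker, ← hs]
      simp [hη']
  choose Θ hΘ1 hΘ2 using h1
  refine Nat.card_eq_of_bijective Θ ⟨?_, ?_⟩
  · intro F F' h
    apply Subtype.ext
    ext x
    obtain ⟨v, y, rfl⟩ := hdec x
    rw [map_add, map_add, hΘ1, hΘ2, hΘ1, hΘ2, h]
  · rintro ⟨⟨s, η⟩, hs, hψ⟩
    obtain ⟨F, hF⟩ := exists_lift_surj (R := R)
      (LinearMap.coprod φ (LinearMap.ker f).subtype) (by
        intro x; obtain ⟨v, y, rfl⟩ := hdec x; exact ⟨(v, y), by simp⟩)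
      (LinearMap.coprod (extV π ψ - extS π ψ ∘ₗ η) (extS π ψ ∘ₗ s)) (by
        rintro ⟨v, y⟩ h
        simp only [LinearMap.coprod_apply, Submodule.subtype_apply] at h
        have hv : v ∈ LinearMap.ker π := by
          have := congrArg f h
          rw [map_add, hφ, map_zero, y.2, add_zero] at this
          exact this
        have hy : y = -⟨φ v, by simp [hφ, LinearMap.mem_ker.1 hv]⟩ := by
          apply Subtype.ext; simp; exact (neg_eq_of_add_eq_zero_right h).symm
        simp only [LinearMap.coprod_apply, LinearMap.sub_apply, LinearMap.comp_apply]
        have h2 := hψ ⟨v, hv⟩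
        have h3 := extV_ker π ψ ⟨v, hv⟩
        simp only at h2 h3
        rw [h3, ← h2, hy, map_neg, map_neg, map_add]
        abel)
    have hF1 : ∀ y : LinearMap.ker f, F y = extS π ψ (s y) := by
      intro y; simpa using hF (0, y)
    have hF2 : ∀ v, F (φ v) = extV π ψ v - extS π ψ (η v) := by
      intro v; simpa using hF (v, 0)
    have hmem : Function.Surjective F ∧ (extG π ψ) ∘ₗ F = f := by
      constructor
      · intro x
        obtain ⟨v, t, rfl⟩ := ext_decomp π ψ x
        obtain ⟨y, hy⟩ := hs (η v + t)
        refine ⟨φ v + y, ?_⟩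
        rw [map_add, hF1, hF2, hy, map_add]; abel
      · ext x
        obtain ⟨v, y, rfl⟩ := hdec x
        simp only [LinearMap.comp_apply]
        rw [map_add, hF1, hF2]
        simp [extG_S, extG_V, hφ]
    refine ⟨⟨F, hmem⟩, ?_⟩
    apply Subtype.ext
    apply Prod.ext
    · ext y
      apply extS_inj π ψ
      rw [← hΘ1, hF1]
    · ext v
      apply extS_inj π ψ
      have := hΘ2 ⟨F, hmem⟩ v
      rw [hF2] at this
      exact (sub_right_injective this).symm

end ext
end P2

set_option linter.style.haveILetI false
set_option linter.unusedSectionVars false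

noncomputable instance (priority := 10) finFTInst {α : Type} [Finite α] : Fintype α :=
  Fintype.ofFinite α

lemma card_fiberwise {α β : Type} [Finite α] [Fintype β] (g : α → β) :
    ∑ b, Nat.card {a // g a = b} = Nat.card α := by
  rw [← Nat.card_sigma]
  exact Nat.card_congr (Equiv.sigmaFiberEquiv g)

section P3
variable {R : Type} [CommRing R]

instance finite_hom (A S : Type) [AddCommGroup A] [Module R A] [AddCommGroup S] [Module R S]
    [Module.Finite R A] [Finite S] : Finite (A →ₗ[R] S) := by
  obtain ⟨n, p, hp⟩ := Module.Finite.exists_fin' R A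
  refine Finite.of_injective (β := Fin n → S) (fun f i => f (p (Pi.single i 1))) ?_
  intro f g h
  have : f ∘ₗ p = g ∘ₗ p := by
    apply LinearMap.pi_ext'
    intro i
    ext
    simpa using congrFun h i
  ext x
  obtain ⟨y, rfl⟩ := hp x
  exact LinearMap.congr_fun this y

/-- the type of surjections -/
abbrev SurjT (R M M' : Type) [CommRing R] [AddCommGroup M] [Module R M]
    [AddCommGroup M'] [Module R M'] : Type := {f : M →ₗ[R] M' // Function.Surjective f}

variable {M M₀ V S : Type} [AddCommGroup M] [Module R M] [AddCommGroup M₀] [Module R M₀]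
  [AddCommGroup V] [Module R V] [AddCommGroup S] [Module R S]

lemma finite_ext [Finite M₀] [Finite S] (π : V →ₗ[R] M₀) (hπ : Function.Surjective π)
    (ψ : LinearMap.ker π →ₗ[R] S) : Finite (ExtMod π ψ) := by
  choose σ hσ using hπ
  refine Finite.of_surjective (α := M₀ × S) (fun p => extV π ψ (σ p.1) + extS π ψ p.2) ?_
  intro x
  obtain ⟨s, hs⟩ := extG_ker π ψ (x - extV π ψ (σ (extG π ψ x))) (by
    rw [map_sub, extG_V, hσ, sub_self])
  exact ⟨(extG π ψ x, s), by simp [← hs]⟩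

lemma ext_total [Finite M] [Finite M₀] [Finite S] [IsNoetherianRing R] [Module.Finite R V]
    [Module.Projective R V]
    (π : V →ₗ[R] M₀) (hπ : Function.Surjective π) [Finite (LinearMap.ker π →ₗ[R] S)] :
    ∑ ψ : LinearMap.ker π →ₗ[R] S, numSurj R M (ExtMod π ψ) =
    (∑ f : SurjT R M M₀, numSurj R (LinearMap.ker f.1) S) * Nat.card (V →ₗ[R] S) := by
  haveI : Finite (V →ₗ[R] S) := finite_hom V S
  haveI : ∀ ψ : LinearMap.ker π →ₗ[R] S, Finite (ExtMod π ψ) := fun ψ => finite_ext π hπ ψ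
  have h1 : ∀ ψ : LinearMap.ker π →ₗ[R] S, numSurj R M (ExtMod π ψ) =
      ∑ f : SurjT R M M₀, Nat.card {F : M →ₗ[R] ExtMod π ψ //
        Function.Surjective F ∧ (extG π ψ) ∘ₗ F = f.1} := by
    intro ψ
    have hGs : Function.Surjective (extG π ψ) := by
      intro m; obtain ⟨v, rfl⟩ := hπ m; exact ⟨extV π ψ v, extG_V π ψ v⟩
    rw [numSurj, ← card_fiberwise (fun F : {F : M →ₗ[R] ExtMod π ψ // Function.Surjective F} =>
      (⟨(extG π ψ) ∘ₗ F.1, hGs.comp F.2⟩ : SurjT R M M₀))]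
    apply Finset.sum_congr rfl
    intro f _
    refine Nat.card_congr ⟨fun F => ⟨F.1.1, F.1.2, congrArg Subtype.val F.2⟩,
      fun F => ⟨⟨F.1, F.2.1⟩, Subtype.ext F.2.2⟩, fun _ => rfl, fun _ => rfl⟩
  simp_rw [h1]
  rw [Finset.sum_comm, Finset.sum_mul]
  apply Finset.sum_congr rfl
  rintro ⟨f, hf⟩ _
  obtain ⟨φ, hφ⟩ := Module.projective_lifting_property f π hf
  have hφ' : ∀ v, f (φ v) = π v := fun v => LinearMap.congr_fun hφ v
  have h2 : ∀ ψ : LinearMap.ker π →ₗ[R] S, _ := fun ψ => ext_card_fiber π hπ ψ f φ hφ'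
  simp_rw [h2]
  let φK : LinearMap.ker π →ₗ[R] LinearMap.ker f :=
    (φ ∘ₗ (LinearMap.ker π).subtype).codRestrict _ (fun x => by simp [hφ'])
  rw [numSurj, ← Nat.card_prod, ← card_fiberwise (fun p : {s : LinearMap.ker f →ₗ[R] S //
    Function.Surjective s} × (V →ₗ[R] S) => p.1.1 ∘ₗ φK + p.2 ∘ₗ (LinearMap.ker π).subtype)]
  apply Finset.sum_congr rfl
  intro ψ _
  refine Nat.card_congr ⟨fun p => ⟨(⟨p.1.1, p.2.1⟩, p.1.2), LinearMap.ext fun x => p.2.2 x⟩,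
      fun p => ⟨(p.1.1.1, p.1.2), p.1.1.2, fun x => LinearMap.congr_fun p.2 x⟩,
      fun _ => rfl, fun _ => rfl⟩

lemma card_hom_eq [Module.Finite R M] [Finite S] :
    Nat.card (M →ₗ[R] S) = ∑ S' : Submodule R S, numSurj R M S' := by
  rw [← card_fiberwise (fun f : M →ₗ[R] S => LinearMap.range f)]
  apply Finset.sum_congr rfl
  intro S' _
  refine Nat.card_congr ⟨fun f => ⟨f.1.codRestrict S' (fun x => (SetLike.ext_iff.1 f.2 _).1 ⟨x, rfl⟩), ?_⟩,
    fun f => ⟨S'.subtype ∘ₗ f.1, ?_⟩, fun _ => rfl, fun _ => rfl⟩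
  · rintro ⟨y, hy⟩
    have : y ∈ LinearMap.range f.1 := (SetLike.ext_iff.1 f.2 _).2 hy
    obtain ⟨x, hx⟩ := this
    exact ⟨x, Subtype.ext hx⟩
  · rw [LinearMap.range_comp_of_range_eq_top _ (LinearMap.range_eq_top.2 f.2),
      Submodule.range_subtype]

section CL
variable {ι : Type} {Mod : ι → ModuleCat.{0} R} [∀ i, Finite (Mod i)] [IsNoetherianRing R]

lemma moment_surj [Finite M₀] [Finite S] [Module.Finite R V] [Module.Projective R V]
    (π : V →ₗ[R] M₀) (hπ : Function.Surjective π)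
    {ν : ι → ℝ} (hν : IsCLMeasure R ι Mod ν) :
    HasSum (fun i => ν i * ∑ f : SurjT R (Mod i) M₀, (numSurj R (LinearMap.ker f.1) S : ℝ))
      (Nat.card (LinearMap.ker π →ₗ[R] S) / Nat.card (V →ₗ[R] S)) := by
  haveI : Finite (V →ₗ[R] S) := finite_hom V S
  haveI : Finite (LinearMap.ker π →ₗ[R] S) := finite_hom _ S
  have h1 : HasSum (fun i => ∑ ψ : LinearMap.ker π →ₗ[R] S,
      ν i * (numSurj R (Mod i) (ExtMod π ψ) : ℝ)) (∑ ψ : LinearMap.ker π →ₗ[R] S, 1) :=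
    hasSum_sum (fun ψ _ => hν.2.2 (ExtMod π ψ) (finite_ext π hπ ψ))
  have hpos : (0 : ℝ) < Nat.card (V →ₗ[R] S) := by exact_mod_cast Nat.card_pos
  have h2 := h1.div_const (Nat.card (V →ₗ[R] S) : ℝ)
  have e1 : (fun i => ν i * ∑ f : SurjT R (Mod i) M₀, (numSurj R (LinearMap.ker f.1) S : ℝ)) =
      fun i => (∑ ψ : LinearMap.ker π →ₗ[R] S,
      ν i * (numSurj R (Mod i) (ExtMod π ψ) : ℝ)) / (Nat.card (V →ₗ[R] S) : ℝ) := by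
    funext i
    have := congrArg (Nat.cast (R := ℝ)) (ext_total (M := Mod i) (S := S) π hπ)
    push_cast at this
    rw [← Finset.mul_sum, this]
    field_simp
  rw [e1]
  simpa [Nat.card_eq_fintype_card] using h2

lemma moment_hom [Finite M₀] [Finite S] :
    ∃ a : ℝ, ∀ ν : ι → ℝ, IsCLMeasure R ι Mod ν →
    HasSum (fun i => ν i * ∑ f : SurjT R (Mod i) M₀, (Nat.card (LinearMap.ker f.1 →ₗ[R] S) : ℝ))
      a := by
  obtain ⟨n, π, hπ⟩ := Module.Finite.exists_fin' R M₀
  refine ⟨∑ S' : Submodule R S, (Nat.card (LinearMap.ker π →ₗ[R] S') /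
    Nat.card ((Fin n → R) →ₗ[R] S') : ℝ), fun ν hν => ?_⟩
  have := hasSum_sum (fun (S' : Submodule R S) (_ : S' ∈ Finset.univ) =>
    moment_surj (S := S') π hπ hν)
  convert this using 1
  ext i
  rw [← Finset.mul_sum, Finset.sum_comm]
  congr 1
  apply Finset.sum_congr rfl
  intro f _
  rw [card_hom_eq]
  push_cast
  rfl

end CL
end P3

set_option linter.style.haveILetI false
set_option linter.unusedSectionVars false

section P4a
variable {R : Type} [CommRing R]

/-- residue field -/
abbrev kk {R : Type} [CommRing R] (j : MaximalSpectrum R) : Type := R ⧸ j.asIdeal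

/-- its cardinality -/
noncomputable abbrev QQ {R : Type} [CommRing R] (j : MaximalSpectrum R) : ℕ := Nat.card (kk j)

variable {L : Type} [AddCommGroup L] [Module R L]

lemma kk_hom_zero {i j : MaximalSpectrum R} (h : i ≠ j) (f : kk i →ₗ[R] kk j) : f = 0 := by
  have h1 : ¬ i.asIdeal ≤ j.asIdeal := fun hle =>
    h (MaximalSpectrum.ext (i.isMaximal.eq_of_le j.isMaximal.ne_top hle))
  obtain ⟨a, ha, hb⟩ := Set.not_subset.1 h1
  ext
  simp only [LinearMap.comp_apply, LinearMap.zero_apply]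
  set y := f (Submodule.mkQ _ 1)
  have h2 : a • y = 0 := by
    rw [← map_smul, ← map_smul]
    have : (Submodule.mkQ i.asIdeal) (a • 1) = 0 := by
      simpa [Ideal.Quotient.eq_zero_iff_mem] using ha
    rw [this, map_zero]
  obtain ⟨b, hb'⟩ := Ideal.Quotient.mk_surjective y
  rw [← hb'] at h2 ⊢
  have h3 : Ideal.Quotient.mk j.asIdeal (a * b) = 0 := h2
  rw [Ideal.Quotient.eq_zero_iff_mem] at h3 ⊢
  exact (j.isMaximal.isPrime.mem_or_mem h3).resolve_left hb

lemma kk_lin {j : MaximalSpectrum R} (f : kk j →ₗ[R] kk j) (x : kk j) : f x = x * f 1 := by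
  obtain ⟨a, rfl⟩ := Ideal.Quotient.mk_surjective x
  have : (Ideal.Quotient.mk j.asIdeal a) = a • (1 : kk j) := by
    rw [Algebra.smul_def, mul_one]; rfl
  rw [this, map_smul, smul_mul_assoc, one_mul]

lemma surj_of_li [Finite (MaximalSpectrum R)] [∀ j : MaximalSpectrum R, Finite (kk j)] {m : ℕ}
    (A : Finset (MaximalSpectrum R))
    (χ : ∀ j : {j // j ∈ A}, Fin m → (L →ₗ[R] kk j.1))
    (h : ∀ j, LinearIndependent (kk j.1) (χ j)) :
    Function.Surjective (LinearMap.pi fun j => LinearMap.pi (χ j)) := by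
  classical
  rw [← LinearMap.range_eq_top]
  by_contra hne
  obtain ⟨j0, ψ, hψ, hle⟩ := exists_char _ hne
  apply hψ
  apply LinearMap.pi_ext'
  intro j
  by_cases hj : j.1 = j0
  · subst hj
    have h1 : ∀ s, ψ s = ∑ i, s j i * ψ (Pi.single j (Pi.single i 1)) := by
      intro s
      have h2 : ψ s = ∑ j', ψ (Pi.single j' (s j')) := by
        rw [← map_sum, Finset.univ_sum_single]
      rw [h2, Finset.sum_eq_single j]
      · have h3 : s j = ∑ i, Pi.single i (s j i) := by rw [Finset.univ_sum_single]
        conv_lhs => rw [h3]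
        have h4 := map_sum (ψ ∘ₗ LinearMap.single R (fun j : {j // j ∈ A} => Fin m → kk j.1) j)
          (fun i => Pi.single i (s j i)) Finset.univ
        simp only [LinearMap.comp_apply, LinearMap.single_apply] at h4
        rw [h4]
        apply Finset.sum_congr rfl
        intro i _
        exact kk_lin (ψ ∘ₗ LinearMap.single R (fun j : {j // j ∈ A} => Fin m → kk j.1) j ∘ₗ
          LinearMap.single R (fun _ : Fin m => kk j.1) i) (s j i)
      · intro j' _ hj'
        have hz : (ψ ∘ₗ LinearMap.single R (fun j : {j // j ∈ A} => Fin m → kk j.1) j') = 0 := by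
          apply LinearMap.pi_ext'
          intro i
          exact kk_hom_zero (fun h => hj' (Subtype.ext h)) _
        exact LinearMap.congr_fun hz (s j')
      · simp
    have h5 : ∑ i, ψ (Pi.single j (Pi.single i 1)) • χ j i = 0 := by
      ext l
      have h6 := hle ⟨l, rfl⟩
      rw [LinearMap.mem_ker, h1] at h6
      simpa [mul_comm] using h6
    have h7 := Fintype.linearIndependent_iff.1 (h j) _ h5
    ext s
    simp only [LinearMap.comp_apply]
    rw [h1]
    simp [h7]
  · apply LinearMap.pi_ext'
    intro i
    exact kk_hom_zero hj _

lemma card_li (j : MaximalSpectrum R) [Finite (kk j)] (W : Type) [AddCommGroup W] [Module (kk j) W]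
    [Finite W] (m : ℕ) : ∃ d : ℕ, Nat.card W = QQ j ^ d ∧ 
      (Nat.card {s : Fin m → W // LinearIndependent (kk j) s} : ℝ) =
        ∏ i : Fin m, ((QQ j : ℝ) ^ d - (QQ j : ℝ) ^ (i : ℕ)) := by
  letI : Field (kk j) := Ideal.Quotient.field j.asIdeal
  have hW : Nat.card W = QQ j ^ (Module.finrank (kk j) W) := Module.natCard_eq_pow_finrank
  refine ⟨Module.finrank (kk j) W, hW, ?_⟩
  by_cases hm : m ≤ Module.finrank (kk j) W
  · rw [card_linearIndependent hm, Nat.cast_prod]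
    apply Finset.prod_congr rfl
    intro i _
    rw [← Nat.card_eq_fintype_card, Nat.cast_sub]
    · push_cast; rfl
    · exact Nat.pow_le_pow_right Nat.card_pos (by omega)
  · push Not at hm
    rw [Finset.prod_eq_zero (i := (⟨_, hm⟩ : Fin m)) (Finset.mem_univ _) (by simp)]
    have : IsEmpty {s : Fin m → W // LinearIndependent (kk j) s} := by
      constructor
      rintro ⟨s, hs⟩
      have := hs.fintype_card_le_finrank
      simp at this
      omega
    simp

end P4a

set_option linter.style.haveILetI false
set_option linter.unusedSectionVars false

section P4b
variable {R : Type} [CommRing R] 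

lemma QQ_two (j : MaximalSpectrum R) [Finite (kk j)] : (2 : ℝ) ≤ QQ j := by
  haveI : Nontrivial (kk j) := Ideal.Quotient.nontrivial_iff.2 j.isMaximal.ne_top
  have : 1 < Nat.card (kk j) := Finite.one_lt_card
  exact_mod_cast this

variable [Finite (MaximalSpectrum R)] [∀ j : MaximalSpectrum R, Finite (kk j)]

/-- test module -/
abbrev SA {R : Type} [CommRing R] (m : ℕ) (A : Finset (MaximalSpectrum R)) : Type :=
  ∀ j : {j // j ∈ A}, Fin m → kk j.1

/-- weight -/
noncomputable def wj (m : ℕ) (j : MaximalSpectrum R) : ℝ :=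
  ∏ i : Fin m, 2 / (QQ j : ℝ) ^ ((i : ℕ) + 1)

/-- one factor -/
noncomputable def Fj (m : ℕ) (L : Type) [AddCommGroup L] [Module R L] (j : MaximalSpectrum R) : ℝ :=
  ∏ i : Fin m, (1 - (Nat.card (L →ₗ[R] kk j) : ℝ) / (QQ j : ℝ) ^ ((i : ℕ) + 1))

/-- the test function -/
noncomputable def FF (m : ℕ) (L : Type) [AddCommGroup L] [Module R L] : ℝ :=
  ∏ j : MaximalSpectrum R, Fj m L j

/-- bound -/
noncomputable def BB (m : ℕ) (L : Type) [AddCommGroup L] [Module R L] : ℝ :=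
  ∑ A ∈ (Finset.univ : Finset (Finset (MaximalSpectrum R))) with A.Nonempty,
    (∏ j ∈ A, wj m j) * numSurj R L (SA m A)

variable {L : Type} [AddCommGroup L] [Module R L] [Finite L]

lemma wj_nonneg (m : ℕ) (j : MaximalSpectrum R) : 0 ≤ wj m j :=
  Finset.prod_nonneg fun i _ => by positivity

lemma BB_nonneg (m : ℕ) : 0 ≤ BB (R := R) m L :=
  Finset.sum_nonneg fun _ _ => mul_nonneg (Finset.prod_nonneg fun j _ => wj_nonneg m j)
    (Nat.cast_nonneg _)

lemma li_le_surj (m : ℕ) (A : Finset (MaximalSpectrum R)) :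
    ∏ j ∈ A, Nat.card {s : Fin m → (L →ₗ[R] kk j) // LinearIndependent (kk j) s} ≤
      numSurj R L (SA m A) := by
  rw [← Finset.prod_coe_sort A
    (fun j => Nat.card {s : Fin m → (L →ₗ[R] kk j) // LinearIndependent (kk j) s}), ← Nat.card_pi]
  refine Nat.card_le_card_of_injective (fun χ => ⟨LinearMap.pi fun j => LinearMap.pi (χ j).1,
    surj_of_li A (fun j => (χ j).1) (fun j => (χ j).2)⟩) ?_
  intro χ χ' h
  funext j
  apply Subtype.ext
  funext i
  ext x
  have := LinearMap.congr_fun (Subtype.ext_iff.1 h) x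
  exact congrFun (congrFun this j) i

lemma Fj_bound (m : ℕ) (j : MaximalSpectrum R) :
    (Nat.card (L →ₗ[R] kk j) = 1 ∧ |Fj m L j| ≤ 1) ∨
    (Nat.card (L →ₗ[R] kk j) ≠ 1 ∧ |Fj m L j| ≤ wj m j *
      Nat.card {s : Fin m → (L →ₗ[R] kk j) // LinearIndependent (kk j) s}) := by
  have hQ := QQ_two j
  by_cases h1 : Nat.card (L →ₗ[R] kk j) = 1
  · left
    refine ⟨h1, ?_⟩
    rw [Fj, Finset.abs_prod]
    apply Finset.prod_le_one (fun _ _ => abs_nonneg _)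
    intro i _
    have : (1 : ℝ) ≤ (QQ j : ℝ) ^ ((i : ℕ) + 1) := one_le_pow₀ (by linarith)
    rw [h1, abs_le]
    have h2 : ((1 : ℕ) : ℝ) / (QQ j : ℝ) ^ ((i : ℕ) + 1) ≤ 1 := by
      rw [div_le_one (by linarith)]; simpa using this
    have h3 : 0 ≤ ((1 : ℕ) : ℝ) / (QQ j : ℝ) ^ ((i : ℕ) + 1) := by positivity
    constructor <;> linarith
  · right
    refine ⟨h1, ?_⟩
    obtain ⟨d, hd, hli⟩ := card_li j (L →ₗ[R] kk j) m
    have hd0 : d ≠ 0 := by rintro rfl; simp at hd; exact h1 (by simpa using hd)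
    by_cases hdm : d ≤ m
    · have : Fj m L j = 0 := by
        rw [Fj]
        apply Finset.prod_eq_zero (i := (⟨d - 1, by omega⟩ : Fin m)) (Finset.mem_univ _)
        rw [hd]
        have : d - 1 + 1 = d := by omega
        simp only [this, Nat.cast_pow]
        rw [div_self (by positivity), sub_self]
      rw [this, abs_zero]
      exact mul_nonneg (wj_nonneg m j) (Nat.cast_nonneg _)
    · rw [hli, Fj, wj, Finset.abs_prod, ← Finset.prod_mul_distrib]
      apply Finset.prod_le_prod (fun _ _ => abs_nonneg _)
      intro i _
      have hi : (i : ℕ) + 1 ≤ d := by omega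
      have hp : (0 : ℝ) < (QQ j : ℝ) ^ (i : ℕ) := by positivity
      have h2 : (QQ j : ℝ) ^ ((i : ℕ) + 1) ≤ (QQ j : ℝ) ^ d := pow_le_pow_right₀ (by linarith) hi
      have h3 : 2 * (QQ j : ℝ) ^ (i : ℕ) ≤ (QQ j : ℝ) ^ ((i : ℕ) + 1) := by
        rw [pow_succ]; nlinarith
      have hp1 : (0 : ℝ) < (QQ j : ℝ) ^ ((i : ℕ) + 1) := by positivity
      rw [hd, Nat.cast_pow, abs_of_nonpos, neg_sub, div_mul_eq_mul_div, div_sub_one hp1.ne']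
      · gcongr
        linarith
      · rw [sub_nonpos, one_le_div hp1]
        exact h2

lemma FF_bound [Nontrivial L] (m : ℕ) : |FF (R := R) m L| ≤ BB (R := R) m L := by
  classical
  let A : Finset (MaximalSpectrum R) :=
    Finset.univ.filter fun j => Nat.card (L →ₗ[R] kk j) ≠ 1
  have hA : A.Nonempty := by
    obtain ⟨j, χ, hχ, -⟩ := exists_char (⊥ : Submodule R L) bot_ne_top
    refine ⟨j, ?_⟩
    simp only [A, Finset.mem_filter, Finset.mem_univ, true_and]
    intro h
    rw [Nat.card_eq_one_iff_unique] at h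
    exact hχ (h.1.elim _ _)
  calc |FF (R := R) m L| = ∏ j : MaximalSpectrum R, |Fj m L j| := by rw [FF, Finset.abs_prod]
    _ ≤ ∏ j : MaximalSpectrum R, (if j ∈ A then wj m j *
      (Nat.card {s : Fin m → (L →ₗ[R] kk j) // LinearIndependent (kk j) s} : ℝ) else 1) := by
        apply Finset.prod_le_prod (fun _ _ => abs_nonneg _)
        intro j _
        rcases Fj_bound (L := L) m j with h | h
        · rw [if_neg (by simp only [A, Finset.mem_filter, not_and, not_not]; exact fun _ => h.1)]; exact h.2
        · rw [if_pos (by simp only [A, Finset.mem_filter, Finset.mem_univ, true_and]; exact h.1)]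
          exact h.2
    _ = (∏ j ∈ A, wj m j) *
        ((∏ j ∈ A, Nat.card {s : Fin m → (L →ₗ[R] kk j) // LinearIndependent (kk j) s} : ℕ) : ℝ) := by
        rw [Finset.prod_ite_mem, Finset.univ_inter, Finset.prod_mul_distrib]
        push_cast
        rfl
    _ ≤ (∏ j ∈ A, wj m j) * (numSurj R L (SA m A) : ℝ) := by
        apply mul_le_mul_of_nonneg_left _ (Finset.prod_nonneg fun j _ => wj_nonneg m j)
        exact_mod_cast li_le_surj m A
    _ ≤ BB m L := by
        unfold BB
        apply Finset.single_le_sum (f := fun A => (∏ j ∈ A, wj m j) * (numSurj R L (SA m A) : ℝ))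
        · intro A _
          exact mul_nonneg (Finset.prod_nonneg fun j _ => wj_nonneg m j) (Nat.cast_nonneg _)
        · simp [hA]

lemma FF_expand (m : ℕ) :
    FF (R := R) m L = ∑ U : Finset (MaximalSpectrum R × Fin m),
      (∏ t ∈ U, - (1 / (QQ t.1 : ℝ) ^ ((t.2 : ℕ) + 1))) *
        Nat.card (L →ₗ[R] (∀ t : {t // t ∈ U}, kk t.1.1)) := by
  classical
  have h1 : FF (R := R) m L = ∏ t : MaximalSpectrum R × Fin m,
      (1 + - (1 / (QQ t.1 : ℝ) ^ ((t.2 : ℕ) + 1)) * Nat.card (L →ₗ[R] kk t.1)) := by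
    rw [FF, Fintype.prod_prod_type]
    apply Finset.prod_congr rfl
    intro j _
    apply Finset.prod_congr rfl
    intro i _
    ring
  rw [h1, Finset.prod_one_add, Finset.powerset_univ]
  apply Finset.sum_congr rfl
  intro U _
  rw [Finset.prod_mul_distrib]
  congr 1
  rw [← Nat.cast_prod, ← Finset.prod_coe_sort U (fun t => Nat.card (L →ₗ[R] kk t.1)),
    ← Nat.card_pi]
  congr 1
  exact Nat.card_congr ⟨fun f => LinearMap.pi f, fun f t => LinearMap.proj t ∘ₗ f,
    fun _ => rfl, fun _ => rfl⟩

end P4b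

set_option linter.style.haveILetI false
set_option linter.unusedSectionVars false
open Filter Topology

section P4c
variable {R : Type} [CommRing R] 
variable [Finite (MaximalSpectrum R)] [∀ j : MaximalSpectrum R, Finite (kk j)]

/-- finite level constant -/
noncomputable def cm (R : Type) [CommRing R] [Finite (MaximalSpectrum R)] (m : ℕ) : ℝ :=
  ∏ j : MaximalSpectrum R, ∏ i : Fin m, (1 - 1 / (QQ j : ℝ) ^ ((i : ℕ) + 1))

lemma FF_sub {L : Type} [AddCommGroup L] [Module R L] [Subsingleton L] (m : ℕ) :
    FF (R := R) m L = cm R m := by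
  unfold FF Fj cm
  have : ∀ j : MaximalSpectrum R, Nat.card (L →ₗ[R] kk j) = 1 := by
    intro j
    rw [Nat.card_eq_one_iff_unique]
    refine ⟨⟨fun f g => ?_⟩, ⟨0⟩⟩
    ext x
    rw [Subsingleton.elim x 0, map_zero, map_zero]
  simp only [this, Nat.cast_one]

lemma cterm_pos (j : MaximalSpectrum R) (i : ℕ) : 0 < 1 - 1 / (QQ j : ℝ) ^ (i + 1) := by
  have hQ := QQ_two j
  rw [sub_pos, div_lt_one (by positivity)]
  exact one_lt_pow₀ (by linarith) (by omega)

lemma cm_pos (m : ℕ) : 0 < cm R m :=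
  Finset.prod_pos fun j _ => Finset.prod_pos fun i _ => cterm_pos j i

lemma cj_summable (j : MaximalSpectrum R) :
    Summable fun i : ℕ => ‖(-((QQ j : ℝ)⁻¹ ^ (i + 1)))‖ := by
  have hQ := QQ_two j
  have h1 : ‖(QQ j : ℝ)⁻¹‖ < 1 := by
    rw [norm_inv, Real.norm_of_nonneg (by linarith)]
    exact inv_lt_one_of_one_lt₀ (by linarith)
  simp only [norm_neg, norm_pow]
  exact (summable_nat_add_iff 1).2 (summable_geometric_of_lt_one (norm_nonneg _) h1)

lemma cj_tendsto (j : MaximalSpectrum R) :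
    Tendsto (fun m : ℕ => ∏ i : Fin m, (1 - 1 / (QQ j : ℝ) ^ ((i : ℕ) + 1))) atTop
      (𝓝 (∏' i : ℕ, (1 - (QQ j : ℝ)⁻¹ ^ (i + 1)))) := by
  have h := (multipliable_one_add_of_summable (cj_summable j)).hasProd.tendsto_prod_nat
  simp only [← sub_eq_add_neg] at h
  refine h.congr fun m => ?_
  rw [Finset.prod_range]
  simp [inv_pow]

lemma cj_pos (j : MaximalSpectrum R) : 0 < ∏' i : ℕ, (1 - (QQ j : ℝ)⁻¹ ^ (i + 1)) := by
  have h0 : 0 ≤ ∏' i : ℕ, (1 - (QQ j : ℝ)⁻¹ ^ (i + 1)) :=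
    ge_of_tendsto' (cj_tendsto j) fun m => Finset.prod_nonneg fun i _ => (cterm_pos j i).le
  have h1 := tprod_one_add_ne_zero_of_summable (f := fun i : ℕ => -((QQ j : ℝ)⁻¹ ^ (i + 1)))
    (fun i => by
      have := cterm_pos j i
      rw [← sub_eq_add_neg, inv_pow, ← one_div]
      exact this.ne') (cj_summable j)
  simp only [← sub_eq_add_neg] at h1
  exact lt_of_le_of_ne h0 h1.symm

lemma cProd_eq : cProd R = ∏ j : MaximalSpectrum R, ∏' i : ℕ, (1 - (QQ j : ℝ)⁻¹ ^ (i + 1)) := by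
  rw [cProd, finprod_eq_prod_of_fintype]

lemma cProd_pos : 0 < cProd R := by
  rw [cProd_eq]
  exact Finset.prod_pos fun j _ => cj_pos j

lemma cm_tendsto : Tendsto (fun m => cm R m) atTop (𝓝 (cProd R)) := by
  rw [cProd_eq]
  exact tendsto_finsetProd _ fun j _ => cj_tendsto j

lemma err_tendsto (j : MaximalSpectrum R) (H : ℝ) (hH : 0 < H) :
    Tendsto (fun m => wj m j * H ^ m) atTop (𝓝 0) := by
  have hQ := QQ_two j
  have h1 : Tendsto (fun m : ℕ => 2 * H * ((QQ j : ℝ)⁻¹ ^ (m + 1))) atTop (𝓝 0) := by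
    have : Tendsto (fun m : ℕ => (QQ j : ℝ)⁻¹ ^ (m + 1)) atTop (𝓝 0) :=
      (tendsto_add_atTop_iff_nat 1).2 (tendsto_pow_atTop_nhds_zero_of_lt_one (by positivity)
        (inv_lt_one_of_one_lt₀ (by linarith)))
    simpa using this.const_mul (2 * H)
  apply Summable.tendsto_atTop_zero
  apply summable_of_ratio_test_tendsto_lt_one (l := 0) (by norm_num)
  · refine Eventually.of_forall fun m => ?_
    have : 0 < wj m j := Finset.prod_pos fun i _ => by positivity
    positivity
  · refine h1.congr fun m => ?_
    have h2 : 0 < wj m j := Finset.prod_pos fun i _ => by positivity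
    have h3 : wj (m + 1) j = wj m j * (2 / (QQ j : ℝ) ^ (m + 1)) := by
      rw [wj, Fin.prod_univ_castSucc]; rfl
    rw [h3, Real.norm_of_nonneg (by positivity), Real.norm_of_nonneg (by positivity), inv_pow,
      pow_succ H]
    field_simp
end P4c

set_option linter.style.haveILetI false
set_option linter.unusedSectionVars false
open Filter Topology

section P4d
variable {R : Type} [CommRing R] 
variable [Finite (MaximalSpectrum R)] [∀ j : MaximalSpectrum R, Finite (kk j)] [IsNoetherianRing R]
variable {ι : Type} {Mod : ι → ModuleCat.{0} R} [∀ i, Finite (Mod i)]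

lemma hasSum_cg {α : Type} {f g : α → ℝ} {a : ℝ} (h : HasSum f a) (e : ∀ i, g i = f i) :
    HasSum g a := (funext e : g = f) ▸ h

lemma card_hom_SA (K : Type) [AddCommGroup K] [Module R K] (m : ℕ)
    (A : Finset (MaximalSpectrum R)) :
    Nat.card (K →ₗ[R] SA m A) = ∏ j ∈ A, Nat.card (K →ₗ[R] kk j) ^ m := by
  rw [← Finset.prod_coe_sort A (fun j => Nat.card (K →ₗ[R] kk j) ^ m)]
  have : Nat.card (K →ₗ[R] SA m A) =
      Nat.card (∀ j : {j // j ∈ A}, Fin m → (K →ₗ[R] kk j.1)) :=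
    Nat.card_congr ⟨fun f j i => LinearMap.proj i ∘ₗ LinearMap.proj j ∘ₗ f,
      fun f => LinearMap.pi fun j => LinearMap.pi (f j), fun _ => rfl, fun _ => rfl⟩
  rw [this, Nat.card_pi]
  apply Finset.prod_congr rfl
  intro j _
  rw [Nat.card_fun, Nat.card_eq_fintype_card (α := Fin m), Fintype.card_fin]

/-- error term -/
noncomputable def eps (K : Type) [AddCommGroup K] [Module R K] (m : ℕ) : ℝ :=
  ∑ A ∈ (Finset.univ : Finset (Finset (MaximalSpectrum R))) with A.Nonempty,
    ∏ j ∈ A, (wj m j * (Nat.card (K →ₗ[R] kk j) : ℝ) ^ m)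

lemma eps_tendsto (K : Type) [AddCommGroup K] [Module R K] [Module.Finite R K] :
    Tendsto (fun m => eps (R := R) K m) atTop (𝓝 0) := by
  rw [← Finset.sum_const_zero (s := (Finset.univ : Finset (Finset (MaximalSpectrum R))).filter
    fun A => A.Nonempty)]
  apply tendsto_finsetSum
  intro A hA
  have h : Tendsto (fun m => ∏ j ∈ A, (wj m j * (Nat.card (K →ₗ[R] kk j) : ℝ) ^ m)) atTop
      (𝓝 (∏ j ∈ A, 0)) :=
    tendsto_finsetProd _ fun j _ => err_tendsto j _ (by exact_mod_cast Nat.card_pos)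
  have hA' : A.Nonempty := by simpa using hA
  rwa [Finset.prod_const, zero_pow (Finset.card_ne_zero.2 hA')] at h

lemma moment_FF (M₀ : Type) [AddCommGroup M₀] [Module R M₀] [Finite M₀] (m : ℕ) :
    ∃ τ : ℝ, ∀ ν : ι → ℝ, IsCLMeasure R ι Mod ν →
      HasSum (fun i => ν i * ∑ f : SurjT R (Mod i) M₀, FF (R := R) m (LinearMap.ker f.1)) τ := by
  have hh : ∀ U : Finset (MaximalSpectrum R × Fin m), ∃ a : ℝ, ∀ ν : ι → ℝ, IsCLMeasure R ι Mod ν →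
      HasSum (fun i => ν i * ∑ f : SurjT R (Mod i) M₀, (Nat.card (LinearMap.ker f.1 →ₗ[R] 
        (∀ t : {t // t ∈ U}, kk t.1.1)) : ℝ)) a := fun U => moment_hom
  choose a ha using hh
  refine ⟨∑ U : Finset (MaximalSpectrum R × Fin m),
    (∏ t ∈ U, - (1 / (QQ t.1 : ℝ) ^ ((t.2 : ℕ) + 1))) * a U, fun ν hν => ?_⟩
  have := hasSum_sum (fun (U : Finset (MaximalSpectrum R × Fin m)) (_ : U ∈ Finset.univ) =>
    (ha U ν hν).mul_left (∏ t ∈ U, - (1 / (QQ t.1 : ℝ) ^ ((t.2 : ℕ) + 1))))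
  refine hasSum_cg this fun i => ?_
  simp only [Finset.mul_sum]
  rw [Finset.sum_comm]
  apply Finset.sum_congr rfl
  intro f _
  rw [FF_expand, Finset.mul_sum]
  apply Finset.sum_congr rfl
  intro U _
  ring

lemma moment_BB {M₀ V : Type} [AddCommGroup M₀] [Module R M₀] [Finite M₀]
    [AddCommGroup V] [Module R V] [Module.Finite R V] [Module.Projective R V]
    (π : V →ₗ[R] M₀) (hπ : Function.Surjective π) (m : ℕ)
    {ν : ι → ℝ} (hν : IsCLMeasure R ι Mod ν) :
    ∃ β : ℝ, β ≤ eps (R := R) (LinearMap.ker π) m ∧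
      HasSum (fun i => ν i * ∑ f : SurjT R (Mod i) M₀, BB (R := R) m (LinearMap.ker f.1)) β := by
  have := hasSum_sum (fun (A : Finset (MaximalSpectrum R))
    (_ : A ∈ (Finset.univ : Finset (Finset (MaximalSpectrum R))).filter fun A => A.Nonempty) =>
    (moment_surj (S := SA m A) π hπ hν).mul_left (∏ j ∈ A, wj m j))
  refine ⟨_, ?_, hasSum_cg this fun i => ?_⟩
  rotate_left
  · simp only [Finset.mul_sum]
    rw [Finset.sum_comm]
    apply Finset.sum_congr rfl
    intro f _
    rw [BB, Finset.mul_sum]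
    apply Finset.sum_congr rfl
    intro U _
    ring
  · unfold eps
    apply Finset.sum_le_sum
    intro A _
    rw [Finset.prod_mul_distrib]
    apply mul_le_mul_of_nonneg_left _ (Finset.prod_nonneg fun j _ => wj_nonneg m j)
    have hc : (1 : ℝ) ≤ Nat.card (V →ₗ[R] SA m A) := by exact_mod_cast Nat.card_pos
    calc _ ≤ (Nat.card (LinearMap.ker π →ₗ[R] SA m A) : ℝ) := div_le_self (by positivity) hc
      _ = _ := by rw [card_hom_SA]; push_cast; rfl

lemma main_bound (hirr : ∀ i j, Nonempty ((Mod i : Type) ≃ₗ[R] Mod j) → i = j) (i₀ : ι)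
    {V : Type} [AddCommGroup V] [Module R V] [Module.Finite R V] [Module.Projective R V]
    (π : V →ₗ[R] Mod i₀) (hπ : Function.Surjective π) (m : ℕ)
    {ν : ι → ℝ} (hν : IsCLMeasure R ι Mod ν) {τ : ℝ}
    (hτ : HasSum (fun i => ν i * ∑ f : SurjT R (Mod i) (Mod i₀),
      FF (R := R) m (LinearMap.ker f.1)) τ) :
    |τ - ν i₀ * (numSurj R (Mod i₀) (Mod i₀) * cm R m)| ≤ eps (R := R) (LinearMap.ker π) m := by
  obtain ⟨β, hβ, hs⟩ := moment_BB (Mod := Mod) π hπ m hν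
  have h0 : ∑ f : SurjT R (Mod i₀) (Mod i₀), FF (R := R) m (LinearMap.ker f.1) =
      numSurj R (Mod i₀) (Mod i₀) * cm R m := by
    have : ∀ f : SurjT R (Mod i₀) (Mod i₀), FF (R := R) m (LinearMap.ker f.1) = cm R m := by
      intro f
      have hinj := Finite.injective_iff_surjective.2 f.2
      haveI : Subsingleton (LinearMap.ker f.1) := by
        rw [LinearMap.ker_eq_bot.2 hinj]; infer_instance
      exact FF_sub m
    rw [Finset.sum_congr rfl fun f _ => this f, Finset.sum_const, numSurj,
      Nat.card_eq_fintype_card, nsmul_eq_mul, Finset.card_univ]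
  classical
  have h1 := hτ.sub (hasSum_ite_eq i₀ (ν i₀ * (numSurj R (Mod i₀) (Mod i₀) * cm R m)))
  refine le_trans (h1.norm_le_of_bounded hs ?_) hβ
  intro i
  have hνi := hν.1 i
  by_cases hi : i = i₀
  · subst hi
    rw [h0, if_pos rfl, sub_self, norm_zero]
    exact mul_nonneg hνi (Finset.sum_nonneg fun f _ => BB_nonneg m)
  · rw [if_neg hi, sub_zero, norm_mul, Real.norm_of_nonneg hνi]
    apply mul_le_mul_of_nonneg_left _ hνi
    refine (norm_sum_le _ _).trans (Finset.sum_le_sum fun f _ => ?_)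
    haveI : Nontrivial (LinearMap.ker f.1) := by
      rw [Submodule.nontrivial_iff_ne_bot]
      intro hb
      exact hi (hirr _ _ ⟨LinearEquiv.ofBijective f.1 ⟨LinearMap.ker_eq_bot.1 hb, f.2⟩⟩)
    exact FF_bound m

theorem uniq (hirr : ∀ i j, Nonempty ((Mod i : Type) ≃ₗ[R] Mod j) → i = j)
    {ν ν' : ι → ℝ} (hν : IsCLMeasure R ι Mod ν) (hν' : IsCLMeasure R ι Mod ν') : ν = ν' := by
  funext i₀
  obtain ⟨n, π, hπ⟩ := Module.Finite.exists_fin' R (Mod i₀)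
  choose τ hτ using fun m => moment_FF (ι := ι) (Mod := Mod) (Mod i₀) m
  have hs : (0 : ℝ) < numSurj R (Mod i₀) (Mod i₀) := by
    haveI : Nonempty (SurjT R (Mod i₀) (Mod i₀)) := ⟨⟨LinearMap.id, fun x => ⟨x, rfl⟩⟩⟩
    have : 0 < Nat.card (SurjT R (Mod i₀) (Mod i₀)) := Nat.card_pos
    exact_mod_cast this
  have hE := eps_tendsto (R := R) (LinearMap.ker π)
  have lim : ∀ {ν : ι → ℝ}, IsCLMeasure R ι Mod ν → Tendsto (fun m => τ m -
      ν i₀ * (numSurj R (Mod i₀) (Mod i₀) * cm R m)) atTop (𝓝 0) := fun {ν} hν =>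
    squeeze_zero_norm (fun m => main_bound hirr i₀ π hπ m hν (hτ m ν hν)) hE
  have h1 := (lim hν').sub (lim hν)
  have h2 : Tendsto (fun m => (ν i₀ - ν' i₀) * (numSurj R (Mod i₀) (Mod i₀) * cm R m)) atTop
      (𝓝 ((ν i₀ - ν' i₀) * (numSurj R (Mod i₀) (Mod i₀) * cProd R))) :=
    (cm_tendsto.const_mul _).const_mul _
  have h3 := tendsto_nhds_unique h2 ((h1.congr fun m => by ring))
  have hc := cProd_pos (R := R)
  rw [sub_zero] at h3
  rcases mul_eq_zero.1 h3 with h | h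
  · linarith
  · exact absurd h (by positivity)

end P4d

set_option linter.style.haveILetI false
set_option linter.unusedSectionVars false
open Filter Topology

section P5a
variable {R : Type} [CommRing R] {E M : Type} [AddCommGroup E] [Module R E] [Finite E]
  [AddCommGroup M] [Module R M] [Finite M]

lemma numSurj_congr_left {A B C : Type} [AddCommGroup A] [Module R A] [AddCommGroup B] [Module R B]
    [AddCommGroup C] [Module R C] (e : A ≃ₗ[R] B) : numSurj R A C = numSurj R B C := by
  refine Nat.card_congr ⟨fun f => ⟨f.1 ∘ₗ e.symm.toLinearMap, f.2.comp e.symm.surjective⟩,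
    fun f => ⟨f.1 ∘ₗ e.toLinearMap, f.2.comp e.surjective⟩, fun f => ?_, fun f => ?_⟩
  · ext x; simp
  · ext x; simp

lemma numSurj_congr_right {A B C : Type} [AddCommGroup A] [Module R A] [AddCommGroup B] [Module R B]
    [AddCommGroup C] [Module R C] (e : A ≃ₗ[R] B) : numSurj R C A = numSurj R C B := by
  refine Nat.card_congr ⟨fun f => ⟨e.toLinearMap ∘ₗ f.1, e.surjective.comp f.2⟩,
    fun f => ⟨e.symm.toLinearMap ∘ₗ f.1, e.symm.surjective.comp f.2⟩, fun f => ?_, fun f => ?_⟩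
  · ext x; simp
  · ext x; simp

lemma card_range_eq (N : Submodule R E) :
    Nat.card {A : E →ₗ[R] E // LinearMap.range A = N} = numSurj R E N := by
  refine Nat.card_congr ⟨fun f => ⟨f.1.codRestrict N (fun x => (SetLike.ext_iff.1 f.2 _).1 ⟨x, rfl⟩),
    ?_⟩, fun f => ⟨N.subtype ∘ₗ f.1, ?_⟩, fun _ => rfl, fun _ => rfl⟩
  · rintro ⟨y, hy⟩
    have : y ∈ LinearMap.range f.1 := (SetLike.ext_iff.1 f.2 _).2 hy
    obtain ⟨x, hx⟩ := this
    exact ⟨x, Subtype.ext hx⟩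
  · rw [LinearMap.range_comp_of_range_eq_top _ (LinearMap.range_eq_top.2 f.2),
      Submodule.range_subtype]

/-- surjections from a quotient -/
lemma card_surj_quot (N : Submodule R E) :
    numSurj R (E ⧸ N) M = Nat.card {s : SurjT R E M // N ≤ LinearMap.ker s.1} := by
  refine Nat.card_congr ⟨fun f => ⟨⟨f.1 ∘ₗ N.mkQ, f.2.comp N.mkQ_surjective⟩, fun x hx => ?_⟩,
    fun f => ⟨N.liftQ f.1.1 f.2, fun y => ?_⟩, fun f => ?_, fun f => ?_⟩
  · simp [(Submodule.Quotient.mk_eq_zero N).2 hx]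
  · obtain ⟨x, hx⟩ := f.1.2 y
    exact ⟨N.mkQ x, by simpa using hx⟩
  · ext x; simp
  · ext x; simp

lemma card_ker_eq (N : Submodule R E) :
    Nat.card {s : SurjT R E M // LinearMap.ker s.1 = N} = Nat.card ((E ⧸ N) ≃ₗ[R] M) := by
  refine Nat.card_congr ⟨fun f => LinearEquiv.ofBijective (N.liftQ f.1.1 f.2.ge) ⟨?_, ?_⟩,
    fun e => ⟨⟨e.toLinearMap ∘ₗ N.mkQ, e.surjective.comp N.mkQ_surjective⟩, ?_⟩,
    fun f => ?_, fun e => ?_⟩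
  · rw [← LinearMap.ker_eq_bot, Submodule.ker_liftQ_eq_bot _ _ _ f.2.le]
  · intro y
    obtain ⟨x, hx⟩ := f.1.2 y
    exact ⟨N.mkQ x, by simpa using hx⟩
  · ext x; simp
  · ext x; rfl
  · ext x
    obtain ⟨x, rfl⟩ := N.mkQ_surjective x
    rfl

lemma card_equiv {A B : Type} [AddCommGroup A] [Module R A] [AddCommGroup B] [Module R B]
    (h : Nonempty (A ≃ₗ[R] B)) : Nat.card (A ≃ₗ[R] B) = numAut R B := by
  obtain ⟨e⟩ := h
  refine Nat.card_congr ⟨fun f => e.symm.trans f, fun f => e.trans f, fun f => ?_, fun f => ?_⟩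
  · ext x; simp
  · ext x; simp

/-- the first moment of the cokernel -/
lemma coker_moment :
    ∑ A : E →ₗ[R] E, numSurj R (E ⧸ LinearMap.range A) M =
      ∑ s : SurjT R E M, Nat.card (E →ₗ[R] LinearMap.ker s.1) := by
  have h1 : ∀ A : E →ₗ[R] E, numSurj R (E ⧸ LinearMap.range A) M =
      Nat.card {s : SurjT R E M // LinearMap.range A ≤ LinearMap.ker s.1} :=
    fun A => card_surj_quot _
  have h2 : ∀ s : SurjT R E M, Nat.card (E →ₗ[R] LinearMap.ker s.1) =
      Nat.card {A : E →ₗ[R] E // LinearMap.range A ≤ LinearMap.ker s.1} := by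
    intro s
    refine Nat.card_congr ⟨fun f => ⟨(LinearMap.ker s.1).subtype ∘ₗ f, ?_⟩,
      fun f => f.1.codRestrict _ (fun x => f.2 ⟨x, rfl⟩), fun _ => rfl, fun _ => rfl⟩
    rintro _ ⟨x, rfl⟩
    exact (f x).2
  simp_rw [h1, h2]
  rw [← Nat.card_sigma, ← Nat.card_sigma]
  exact Nat.card_congr ⟨fun p => ⟨p.2.1, ⟨p.1, p.2.2⟩⟩, fun p => ⟨p.2.1, ⟨p.1, p.2.2⟩⟩,
    fun _ => rfl, fun _ => rfl⟩

/-- the law of the cokernel -/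
lemma coker_law :
    Nat.card {A : E →ₗ[R] E // Nonempty ((E ⧸ LinearMap.range A) ≃ₗ[R] M)} * numAut R M =
      ∑ s : SurjT R E M, numSurj R E (LinearMap.ker s.1) := by
  have h2 : ∀ s : SurjT R E M, numSurj R E (LinearMap.ker s.1) =
      Nat.card {A : E →ₗ[R] E // LinearMap.range A = LinearMap.ker s.1} :=
    fun s => (card_range_eq _).symm
  have h3 : ∑ A : E →ₗ[R] E, Nat.card {s : SurjT R E M // LinearMap.ker s.1 = LinearMap.range A} =
      ∑ s : SurjT R E M, Nat.card {A : E →ₗ[R] E // LinearMap.range A = LinearMap.ker s.1} := by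
    rw [← Nat.card_sigma, ← Nat.card_sigma]
    exact Nat.card_congr ⟨fun p => ⟨p.2.1, ⟨p.1, p.2.2.symm⟩⟩,
      fun p => ⟨p.2.1, ⟨p.1, p.2.2.symm⟩⟩, fun _ => rfl, fun _ => rfl⟩
  rw [Finset.sum_congr rfl fun s _ => h2 s, ← h3]
  classical
  have h4 : ∀ A : E →ₗ[R] E, Nat.card {s : SurjT R E M // LinearMap.ker s.1 = LinearMap.range A} =
      if Nonempty ((E ⧸ LinearMap.range A) ≃ₗ[R] M) then numAut R M else 0 := by
    intro A
    rw [card_ker_eq]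
    split_ifs with h
    · exact card_equiv h
    · rw [not_nonempty_iff] at h
      exact Nat.card_of_isEmpty
  rw [Finset.sum_congr rfl fun s _ => h4 s, ← Finset.sum_filter, Finset.sum_const, smul_eq_mul]
  congr 1
  rw [Nat.card_eq_fintype_card, Fintype.card_subtype]

end P5a

set_option linter.style.haveILetI false
set_option linter.unusedSectionVars false
open Filter Topology

section P5b
variable {R : Type} [CommRing R]

lemma card_hom_free (n : ℕ) (N : Type) [AddCommGroup N] [Module R N] :
    Nat.card ((Fin n → R) →ₗ[R] N) = Nat.card N ^ n := by
  rw [← Nat.card_congr ((Pi.basisFun R (Fin n)).constr R (M' := N)).toEquiv, Nat.card_fun,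
    Nat.card_eq_fintype_card (α := Fin n), Fintype.card_fin]

/-- proportion of surjections -/
noncomputable def UU (R : Type) [CommRing R] (n : ℕ) (M : Type) [AddCommGroup M] [Module R M] : ℝ :=
  numSurj R (Fin n → R) M / (Nat.card M : ℝ) ^ n

variable {M : Type} [AddCommGroup M] [Module R M] [Finite M]

lemma numSurj_le (n : ℕ) (M : Type) [AddCommGroup M] [Module R M] [Finite M] :
    numSurj R (Fin n → R) M ≤ Nat.card M ^ n := by
  rw [← card_hom_free (R := R)]
  exact Nat.card_le_card_of_injective _ Subtype.val_injective

lemma UU_nonneg (n : ℕ) : 0 ≤ UU R n M := by unfold UU; positivity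

lemma cardpos (M : Type) [AddCommGroup M] [Finite M] : (0 : ℝ) < Nat.card M := by
  exact_mod_cast Nat.card_pos

lemma UU_le_one (n : ℕ) : UU R n M ≤ 1 := by
  have := cardpos M
  rw [UU, div_le_one (by positivity)]
  exact_mod_cast numSurj_le n M

lemma UU_tendsto : Tendsto (fun n => UU R n M) atTop (𝓝 1) := by
  classical
  have hM := cardpos M
  have h1 : ∀ n, UU R n M = 1 - ∑ W ∈ (Finset.univ : Finset (Submodule R M)).erase ⊤,
      (numSurj R (Fin n → R) W : ℝ) / (Nat.card M : ℝ) ^ n := by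
    intro n
    have h2 := card_hom_eq (R := R) (M := Fin n → R) (S := M)
    rw [card_hom_free, ← Finset.add_sum_erase _ _ (Finset.mem_univ (⊤ : Submodule R M)),
      numSurj_congr_right (Submodule.topEquiv : (⊤ : Submodule R M) ≃ₗ[R] M)] at h2
    have h3 := congrArg (Nat.cast (R := ℝ)) h2
    push_cast at h3
    rw [UU, eq_sub_iff_add_eq, ← Finset.sum_div, ← add_div, ← h3, div_self (by positivity)]
  simp_rw [h1]
  have h4 : Tendsto (fun n => ∑ W ∈ (Finset.univ : Finset (Submodule R M)).erase ⊤,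
      (numSurj R (Fin n → R) W : ℝ) / (Nat.card M : ℝ) ^ n) atTop (𝓝 (∑ W ∈ (Finset.univ : Finset (Submodule R M)).erase ⊤, 0)) := by
    apply tendsto_finsetSum
    intro W hW
    have hW' : W ≠ ⊤ := Finset.ne_of_mem_erase hW
    have hlt : (Nat.card W : ℝ) < Nat.card M := by
      have : Nat.card W < Nat.card M := by
        have hss : (W : Set M) ≠ Set.univ := fun h => hW' (SetLike.coe_injective (by simpa using h))
        have := Set.ncard_lt_ncard (Set.ssubset_univ_iff.2 hss) Set.finite_univ
        rwa [Set.ncard_univ] at this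
      exact_mod_cast this
    refine squeeze_zero (fun n => by positivity) (fun n => ?_)
      (tendsto_pow_atTop_nhds_zero_of_lt_one (r := (Nat.card W : ℝ) / Nat.card M)
        (by positivity) ((div_lt_one hM).2 hlt))
    rw [div_pow]
    gcongr
    exact_mod_cast numSurj_le n W
  simpa using h4.const_sub 1

variable (ℓ : ℕ) 

/-- the finite free module -/
abbrev EE (R : Type) [CommRing R] (ℓ n k : ℕ) : Type :=
  (Fin n → R) ⧸ elSub ((ℓ : R) ^ k) (Fin n → R)

lemma EE_kill (n k : ℕ) (x : EE R ℓ n k) : (ℓ : R) ^ k • x = 0 := by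
  obtain ⟨y, rfl⟩ := Submodule.mkQ_surjective _ x
  rw [← map_smul]
  simp only [Submodule.mkQ_apply, Submodule.Quotient.mk_eq_zero]
  exact mem_elSub.2 ⟨y, rfl⟩

lemma EE_hom (n k : ℕ) (N : Type) [AddCommGroup N] [Module R N] (hN : ∀ x : N, (ℓ : R) ^ k • x = 0) :
    Nat.card (EE R ℓ n k →ₗ[R] N) = Nat.card N ^ n := by
  rw [← card_hom_free (R := R)]
  refine Nat.card_congr ⟨fun f => f ∘ₗ Submodule.mkQ _, fun f => Submodule.liftQ _ f ?_,
    fun f => ?_, fun f => ?_⟩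
  · intro x hx
    obtain ⟨y, rfl⟩ := mem_elSub.1 hx
    rw [LinearMap.mem_ker, map_smul, hN]
  · ext x; simp
  · ext x; simp

lemma EE_surj (n k : ℕ) (N : Type) [AddCommGroup N] [Module R N] (hN : ∀ x : N, (ℓ : R) ^ k • x = 0) :
    numSurj R (EE R ℓ n k) N = numSurj R (Fin n → R) N := by
  refine Nat.card_congr ⟨fun f => ⟨f.1 ∘ₗ Submodule.mkQ _, f.2.comp (Submodule.mkQ_surjective _)⟩,
    fun f => ⟨Submodule.liftQ _ f.1 ?_, ?_⟩, fun f => ?_, fun f => ?_⟩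
  · intro x hx
    obtain ⟨y, rfl⟩ := mem_elSub.1 hx
    rw [LinearMap.mem_ker, map_smul, hN]
  · intro y
    obtain ⟨x, hx⟩ := f.2 y
    exact ⟨Submodule.mkQ _ x, by simpa using hx⟩
  · ext x; simp
  · ext x; simp

lemma card_ker_mul {E : Type} [AddCommGroup E] [Module R E] (s : SurjT R E M) :
    Nat.card E = Nat.card M * Nat.card (LinearMap.ker s.1) := by
  rw [Submodule.card_eq_card_quotient_mul_card (LinearMap.ker s.1), mul_comm]
  congr 1
  exact Nat.card_congr (s.1.quotKerEquivOfSurjective s.2).toEquiv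

variable {ℓ} {n k : ℕ} [Finite (EE R ℓ n k)]

lemma EE_moment (hM : ∀ x : M, (ℓ : R) ^ k • x = 0) :
    ∑ A : EE R ℓ n k →ₗ[R] EE R ℓ n k, (numSurj R (EE R ℓ n k ⧸ LinearMap.range A) M : ℝ) =
      UU R n M * Nat.card (EE R ℓ n k →ₗ[R] EE R ℓ n k) := by
  have h := congrArg (Nat.cast (R := ℝ)) (coker_moment (R := R) (E := EE R ℓ n k) (M := M))
  push_cast at h
  rw [h]
  have h1 : ∀ s : SurjT R (EE R ℓ n k) M,
      (Nat.card (EE R ℓ n k →ₗ[R] LinearMap.ker s.1) : ℝ) =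
        (Nat.card (EE R ℓ n k) : ℝ) ^ n / (Nat.card M : ℝ) ^ n := by
    intro s
    rw [EE_hom _ _ _ _ (fun x => Subtype.ext (EE_kill ℓ n k x.1)), card_ker_mul s]
    have := cardpos M
    push_cast
    rw [mul_pow]
    field_simp
  rw [Finset.sum_congr rfl fun s _ => h1 s, Finset.sum_const, nsmul_eq_mul, Finset.card_univ,
    ← Nat.card_eq_fintype_card, EE_hom _ _ _ _ (EE_kill ℓ n k), UU, ← EE_surj ℓ n k M hM, numSurj]
  push_cast
  ring

lemma EE_law (hM : ∀ x : M, (ℓ : R) ^ k • x = 0) (u : ℝ)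
    (hu : ∀ s : SurjT R (EE R ℓ n k) M, UU R n (LinearMap.ker s.1) = u) :
    (Nat.card {A : EE R ℓ n k →ₗ[R] EE R ℓ n k //
      Nonempty ((EE R ℓ n k ⧸ LinearMap.range A) ≃ₗ[R] M)} : ℝ) =
      u * UU R n M / numAut R M * Nat.card (EE R ℓ n k →ₗ[R] EE R ℓ n k) := by
  have h := congrArg (Nat.cast (R := ℝ)) (coker_law (R := R) (E := EE R ℓ n k) (M := M))
  push_cast at h
  have h1 : ∀ s : SurjT R (EE R ℓ n k) M,
      (numSurj R (EE R ℓ n k) (LinearMap.ker s.1) : ℝ) =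
        u * (Nat.card (EE R ℓ n k) : ℝ) ^ n / (Nat.card M : ℝ) ^ n := by
    intro s
    rw [EE_surj ℓ n k _ (fun x => Subtype.ext (EE_kill ℓ n k x.1)), card_ker_mul s, ← hu s, UU]
    have := cardpos M
    have := cardpos (LinearMap.ker s.1)
    push_cast
    rw [mul_pow]
    field_simp
  have ha : (0 : ℝ) < numAut R M := by
    haveI : Finite (M ≃ₗ[R] M) := Finite.of_injective (fun e => (e : M → M)) DFunLike.coe_injective
    haveI : Nonempty (M ≃ₗ[R] M) := ⟨LinearEquiv.refl R M⟩
    have : 0 < Nat.card (M ≃ₗ[R] M) := Nat.card_pos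
    exact_mod_cast this
  rw [Finset.sum_congr rfl fun s _ => h1 s, Finset.sum_const, nsmul_eq_mul, Finset.card_univ,
    ← Nat.card_eq_fintype_card] at h
  rw [EE_hom _ _ _ _ (EE_kill ℓ n k), UU, ← EE_surj ℓ n k M hM, numSurj]
  rw [← eq_div_iff ha.ne'] at h
  rw [h]
  push_cast
  ring

end P5b

set_option linter.style.haveILetI false
set_option linter.unusedSectionVars false
open Filter Topology

section P5c
variable {R : Type} [CommRing R]
variable [Finite (MaximalSpectrum R)] [∀ j : MaximalSpectrum R, Finite (kk j)]

lemma card_lift {n : ℕ} {N S : Type} [AddCommGroup N] [Module R N] [AddCommGroup S] [Module R S]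
    (θ : N →ₗ[R] S) (hθ : Function.Surjective θ) (P : (Fin n → S) → Prop) :
    Nat.card {s : Fin n → N // P (fun i => θ (s i))} =
      Nat.card {σ : Fin n → S // P σ} * Nat.card (LinearMap.ker θ) ^ n := by
  have h : Nat.card (LinearMap.ker θ) ^ n = Nat.card (Fin n → LinearMap.ker θ) := by
    rw [Nat.card_fun, Nat.card_eq_fintype_card (α := Fin n), Fintype.card_fin]
  rw [h, ← Nat.card_prod]
  choose g hg using hθ
  refine Nat.card_congr ⟨fun s => (⟨fun i => θ (s.1 i), s.2⟩,
      fun i => ⟨s.1 i - g (θ (s.1 i)), by simp [hg]⟩),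
    fun p => ⟨fun i => g (p.1.1 i) + (p.2 i).1, ?_⟩, fun s => ?_, fun p => ?_⟩
  · have : (fun i => θ (g (p.1.1 i) + (p.2 i).1)) = p.1.1 := by
      funext i; simp [hg]
    rw [this]; exact p.1.2
  · apply Subtype.ext; funext i; simp
  · apply Prod.ext
    · apply Subtype.ext; funext i; simp [hg]
    · funext i; apply Subtype.ext; simp [hg]

lemma UU_of_hom (n : ℕ) (N : Type) [AddCommGroup N] [Module R N] [Finite N]
    (h : ∀ j : MaximalSpectrum R, Nat.card (N →ₗ[R] kk j) = QQ j ^ n) : UU R n N = cm R n := by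
  classical
  letI : ∀ j : MaximalSpectrum R, Field (kk j) := fun j => Ideal.Quotient.field j.asIdeal
  have hfr : ∀ j : MaximalSpectrum R, Module.finrank (kk j) (N →ₗ[R] kk j) = n := by
    intro j
    have h1 : Nat.card (N →ₗ[R] kk j) = QQ j ^ (Module.finrank (kk j) (N →ₗ[R] kk j)) :=
      Module.natCard_eq_pow_finrank
    rw [h j] at h1
    have h2 : 1 < QQ j := by have := QQ_two j; exact_mod_cast this
    exact (Nat.pow_right_injective h2 h1).symm
  let b : ∀ j : MaximalSpectrum R, Module.Basis (Fin n) (kk j) (N →ₗ[R] kk j) := fun j =>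
    Module.finBasisOfFinrankEq (kk j) (N →ₗ[R] kk j) (hfr j)
  let θ : N →ₗ[R] SA n (Finset.univ : Finset (MaximalSpectrum R)) :=
    LinearMap.pi fun j => LinearMap.pi (b j.1)
  have hθ : Function.Surjective θ := surj_of_li Finset.univ (fun j => b j.1)
    (fun j => (b j.1).linearIndependent)
  have hθa : ∀ x j a, θ x j a = b j.1 a x := fun _ _ _ => rfl
  let P : (Fin n → SA n (Finset.univ : Finset (MaximalSpectrum R))) → Prop :=
    fun σ => ∀ j, LinearIndependent (kk j.1) (fun i => σ i j)
  have key : ∀ s : Fin n → N, Submodule.span R (Set.range s) = ⊤ ↔ P (fun i => θ (s i)) := by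
    intro s
    constructor
    · intro hs j
      apply linearIndependent_of_top_le_span_of_card_eq_finrank
      · intro v _
        obtain ⟨x, hx⟩ := hθ (Pi.single j v)
        have hx' : θ x j = v := by rw [hx]; simp
        rw [← hx']
        have hxs : x ∈ Submodule.span R (Set.range s) := hs ▸ Submodule.mem_top
        clear hx hx'
        induction hxs using Submodule.span_induction with
        | mem x hx => obtain ⟨i, rfl⟩ := hx; exact Submodule.subset_span ⟨i, rfl⟩
        | zero => simp
        | add x y _ _ h1 h2 => rw [map_add]; exact Submodule.add_mem _ h1 h2
        | smul r x _ h1 =>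
          have : θ (r • x) j = (Ideal.Quotient.mk j.1.asIdeal r) • (θ x j) := by
            rw [map_smul]; rfl
          rw [this]
          exact Submodule.smul_mem _ _ h1
      · simp
    · intro hP
      by_contra hne
      obtain ⟨j, χ, hχ, hle⟩ := exists_char _ hne
      apply hχ
      let j' : {j // j ∈ (Finset.univ : Finset (MaximalSpectrum R))} := ⟨j, Finset.mem_univ j⟩
      have h1 : ∀ x, χ x = ∑ a, θ x j' a * (b j).repr χ a := by
        intro x
        conv_lhs => rw [← (b j).sum_repr χ]
        rw [LinearMap.sum_apply]
        apply Finset.sum_congr rfl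
        intro a _
        rw [LinearMap.smul_apply, smul_eq_mul, mul_comm]; rfl
      let lam : (Fin n → kk j) →ₗ[kk j] kk j := ∑ a, (b j).repr χ a • LinearMap.proj a
      have hl : ∀ v, lam v = ∑ a, v a * (b j).repr χ a := by
        intro v; simp [lam, LinearMap.sum_apply, mul_comm]
      have hspan := (hP j').span_eq_top_of_card_eq_finrank' (by simp)
      have hz : lam = 0 := by
        apply LinearMap.ext_on_range hspan
        intro i
        rw [hl]
        have := hle (Submodule.subset_span ⟨i, rfl⟩ : s i ∈ Submodule.span R (Set.range s))
        rw [LinearMap.mem_ker, h1] at this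
        simpa using this
      ext x
      rw [h1, ← hl, hz]; rfl
  have hcount : numSurj R (Fin n → R) N =
      Nat.card {s : Fin n → N // P (fun i => θ (s i))} := by
    refine Nat.card_congr (((Pi.basisFun R (Fin n)).constr R (M' := N)).toEquiv.subtypeEquiv ?_).symm
    intro s
    rw [← key, ← LinearMap.range_eq_top]
    have h0 : (((Pi.basisFun R (Fin n)).constr R (M' := N)).toEquiv s) =
      (Pi.basisFun R (Fin n)).constr R s := rfl
    rw [h0, Module.Basis.constr_range]
  rw [card_lift θ hθ] at hcount
  have hS : Nat.card {σ // P σ} = ∏ j : MaximalSpectrum R,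
      Nat.card {s : Fin n → (Fin n → kk j) // LinearIndependent (kk j) s} := by
    rw [← Finset.prod_coe_sort Finset.univ
      (fun j => Nat.card {s : Fin n → (Fin n → kk j) // LinearIndependent (kk j) s}), ← Nat.card_pi]
    exact Nat.card_congr ⟨fun σ j => ⟨fun i => σ.1 i j, σ.2 j⟩,
      fun σ => ⟨fun i j => (σ j).1 i, fun j => (σ j).2⟩, fun _ => rfl, fun _ => rfl⟩
  have hli : ∀ j : MaximalSpectrum R,
      (Nat.card {s : Fin n → (Fin n → kk j) // LinearIndependent (kk j) s} : ℝ) =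
        ∏ i : Fin n, ((QQ j : ℝ) ^ n - (QQ j : ℝ) ^ (i : ℕ)) := by
    intro j
    obtain ⟨d, hd, hl⟩ := card_li j (Fin n → kk j) n
    rw [Nat.card_fun, Nat.card_eq_fintype_card (α := Fin n), Fintype.card_fin] at hd
    have h2 : 1 < QQ j := by have := QQ_two j; exact_mod_cast this
    rw [hl, Nat.pow_right_injective h2 hd]
  have hN : Nat.card N = (∏ j : MaximalSpectrum R, QQ j ^ n) * Nat.card (LinearMap.ker θ) := by
    rw [card_ker_mul (M := SA n (Finset.univ : Finset (MaximalSpectrum R))) ⟨θ, hθ⟩, Nat.card_pi,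
      ← Finset.prod_coe_sort Finset.univ (fun j : MaximalSpectrum R => QQ j ^ n)]
    congr 1
    apply Finset.prod_congr rfl
    intro j _
    rw [Nat.card_fun, Nat.card_eq_fintype_card (α := Fin n), Fintype.card_fin]
  have hker := cardpos (LinearMap.ker θ)
  rw [UU, hcount, hS, hN]
  push_cast
  rw [mul_pow, mul_div_mul_right _ _ (by positivity), ← Finset.prod_pow, ← Finset.prod_div_distrib,
    cm]
  apply Finset.prod_congr rfl
  intro j _
  have hQ := QQ_two j
  rw [hli j, ← Equiv.prod_comp Fin.revPerm (fun i : Fin n => (1 - 1 / (QQ j : ℝ) ^ ((i : ℕ) + 1)))]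
  have : ((QQ j : ℝ) ^ n) ^ n = ∏ i : Fin n, (QQ j : ℝ) ^ n := by simp
  rw [this, ← Finset.prod_div_distrib]
  apply Finset.prod_congr rfl
  intro i _
  rw [sub_div, div_self (by positivity)]
  congr 1
  rw [div_eq_div_iff (by positivity) (by positivity), one_mul, ← pow_add]
  congr 1
  simp only [Fin.revPerm_apply, Fin.val_rev]
  omega

end P5c

set_option linter.style.haveILetI false
set_option linter.unusedSectionVars false
open Filter Topology

section P5d
variable {R : Type} [CommRing R]

lemma rank_lemma [Finite (MaximalSpectrum R)] {n : ℕ} {K : Type} [AddCommGroup K] [Module R K]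
    [Module.Finite R K] [Module.Projective R K]
    (f : K →ₗ[R] (Fin n → R)) (hf : Function.Injective f)
    (g : (Fin n → R) →ₗ[R] K) (hg : Function.Injective g) :
    Nonempty (Module.Basis (Fin n) R K) := by
  have h1 : ∀ p : PrimeSpectrum R, Module.rankAtStalk K p = n := by
    intro p
    haveI : Nontrivial R := p.nontrivial
    have h2 : Module.rankAtStalk (R := R) (Fin n → R) p = n := by
      rw [Module.rankAtStalk_eq_finrank_of_free]; simp
    rw [← h2]
    apply le_antisymm
    · exact LinearMap.finrank_le_finrank_of_injective
        (f := LocalizedModule.map p.asIdeal.primeCompl f) (LocalizedModule.map_injective _ f hf)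
    · exact LinearMap.finrank_le_finrank_of_injective
        (f := LocalizedModule.map p.asIdeal.primeCompl g) (LocalizedModule.map_injective _ g hg)
  apply Module.nonempty_basis_of_flat_of_finrank_eq
  intro P
  letI : Field (R ⧸ P.1) := Ideal.Quotient.field P.1
  have h3 := Module.rankAtStalk_baseChange (R := R) (M := K) (S := R ⧸ P.1) ⊥
  rw [h1, Module.rankAtStalk_eq_finrank_of_free] at h3
  simpa using h3

lemma proj_ker {V M : Type} [AddCommGroup V] [Module R V] [AddCommGroup M] [Module R M]
    [Module.Projective R V] (g' : V →ₗ[R] M) (hg' : Function.Surjective g')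
    (h : HasProjDimLEOne R M) : Module.Projective R (LinearMap.ker g') := by
  obtain ⟨P₀, P₁, f, g, hP₀, hP₁, hf, hg, hfg⟩ := h
  obtain ⟨a, ha⟩ := Module.projective_lifting_property g g' hg
  obtain ⟨b, hb⟩ := Module.projective_lifting_property g' g hg'
  have ha' : ∀ x, g (a x) = g' x := fun x => LinearMap.congr_fun ha x
  have hb' : ∀ x, g' (b x) = g x := fun x => LinearMap.congr_fun hb x
  have hfg' : ∀ p, g (f p) = 0 := fun p => by
    have : f p ∈ LinearMap.ker g := hfg ▸ ⟨p, rfl⟩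
    exact this
  let e := LinearEquiv.ofInjective f hf
  let i : LinearMap.ker g' →ₗ[R] P₁ × V :=
    LinearMap.prod (e.symm.toLinearMap ∘ₗ (a ∘ₗ (LinearMap.ker g').subtype).codRestrict
      (LinearMap.range f) (fun x => by rw [hfg, LinearMap.mem_ker]; simp [ha'])) (LinearMap.ker g').subtype
  let s : P₁ × V →ₗ[R] LinearMap.ker g' :=
    (LinearMap.coprod (b ∘ₗ f) (LinearMap.id - b ∘ₗ a)).codRestrict (LinearMap.ker g')
      (fun x => by simp [hb', hfg', ha'])
  refine Module.Projective.of_split i s ?_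
  ext x
  have : f (e.symm ⟨a x.1, by rw [hfg, LinearMap.mem_ker, ha']; exact x.2⟩) = a x.1 := by
    have := LinearEquiv.apply_symm_apply e ⟨a x.1, by rw [hfg, LinearMap.mem_ker, ha']; exact x.2⟩
    exact congrArg Subtype.val this
  have h2 : (s (i x)).1 = b (f (e.symm ⟨a x.1, by rw [hfg, LinearMap.mem_ker, ha']; exact x.2⟩))
    + (x.1 - b (a x.1)) := rfl
  simp only [LinearMap.comp_apply, LinearMap.id_apply]
  rw [h2, this]; abel

variable (ℓ : ℕ) [Fact ℓ.Prime] [Algebra ℤ_[ℓ] R] [Module.Finite ℤ_[ℓ] R] [Module.Free ℤ_[ℓ] R]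
  [Finite (MaximalSpectrum R)] [∀ j : MaximalSpectrum R, Finite (kk j)]

lemma key_lemma {n k : ℕ} {M : Type} [AddCommGroup M] [Module R M]
    (hM : ∀ x : M, (ℓ : R) ^ k • x = 0) (s : SurjT R (EE R ℓ n (k + 1)) M) :
    (HasProjDimLEOne R M → UU R n (LinearMap.ker s.1) = cm R n) ∧
    (¬ HasProjDimLEOne R M → UU R n (LinearMap.ker s.1) = 0) := by
  haveI := noeth (R := R) ℓ
  haveI : Finite (EE R ℓ n (k + 1)) := finite_quot ℓ _ _
  let g' : (Fin n → R) →ₗ[R] M := s.1 ∘ₗ Submodule.mkQ _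
  have hg' : Function.Surjective g' := s.2.comp (Submodule.mkQ_surjective _)
  let K := LinearMap.ker g'
  let π : K →ₗ[R] LinearMap.ker s.1 :=
    ((Submodule.mkQ (elSub ((ℓ : R) ^ (k + 1)) (Fin n → R))) ∘ₗ K.subtype).codRestrict _
      (fun x => x.2)
  have hπ : Function.Surjective π := by
    rintro ⟨y, hy⟩
    obtain ⟨x, rfl⟩ := Submodule.mkQ_surjective _ y
    exact ⟨⟨x, hy⟩, rfl⟩
  have hπk : ∀ x : K, π x = 0 → ∃ y : K, (ℓ : R) • y = x := by
    intro x hx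
    have h1 : Submodule.mkQ (elSub ((ℓ : R) ^ (k + 1)) (Fin n → R)) x.1 = 0 :=
      congrArg Subtype.val hx
    rw [Submodule.mkQ_apply, Submodule.Quotient.mk_eq_zero] at h1
    obtain ⟨y, hy⟩ := mem_elSub.1 h1
    refine ⟨⟨(ℓ : R) ^ k • y, ?_⟩, ?_⟩
    · rw [LinearMap.mem_ker, map_smul, hM]
    · apply Subtype.ext
      simp only [SetLike.val_smul]
      rw [← hy, smul_smul, pow_succ']
  let g : (Fin n → R) →ₗ[R] K := ((ℓ : R) ^ k • LinearMap.id).codRestrict K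
    (fun x => by rw [LinearMap.mem_ker]; simp [hM])
  have hg : Function.Injective g := by
    rw [injective_iff_map_eq_zero]
    intro x hx
    have h1 : (ℓ : R) ^ k • x = 0 := congrArg Subtype.val hx
    funext i
    exact ell_reg ℓ k (x i) (congrFun h1 i)
  constructor
  · intro hpd
    haveI : Module.Projective R K := proj_ker g' hg' hpd
    obtain ⟨b⟩ := rank_lemma K.subtype K.injective_subtype g hg
    apply UU_of_hom
    intro j
    have h1 : Nat.card (K →ₗ[R] kk j) = QQ j ^ n := by
      rw [← card_hom_free (R := R)]
      exact Nat.card_congr (b.equivFun.congrLeft (kk j) R).toEquiv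
    rw [← h1]
    have hlk : ∀ x : kk j, (ℓ : R) • x = 0 := by
      intro x
      have := ell_mem ℓ j.asIdeal
      obtain ⟨x, rfl⟩ := Ideal.Quotient.mk_surjective x
      exact Ideal.Quotient.eq_zero_iff_mem.2 (Ideal.mul_mem_right _ _ this)
    refine Nat.card_eq_of_bijective (fun χ => χ ∘ₗ π) ⟨fun χ χ' h => ?_, fun χ => ?_⟩
    · ext x
      obtain ⟨x, rfl⟩ := hπ x
      exact LinearMap.congr_fun h x
    · obtain ⟨F, hF⟩ := exists_lift_surj π hπ χ (fun x hx => by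
        obtain ⟨y, rfl⟩ := hπk x hx
        rw [map_smul, hlk])
      exact ⟨F, LinearMap.ext hF⟩
  · intro hpd
    by_contra hU
    apply hpd
    have h1 : numSurj R (Fin n → R) (LinearMap.ker s.1) ≠ 0 := by
      intro h; apply hU; rw [UU, h]; simp
    have h2 : Nonempty (SurjT R (Fin n → R) (LinearMap.ker s.1)) := by
      rw [numSurj] at h1
      exact (Nat.card_ne_zero.1 h1).1
    obtain ⟨σ, hσ⟩ := h2
    obtain ⟨A, hA⟩ := Module.projective_lifting_property π σ hπ
    have hA' : ∀ x, π (A x) = σ x := fun x => LinearMap.congr_fun hA x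
    have hsurj : LinearMap.range A = ⊤ := by
      rw [eq_top_iff]
      apply Submodule.le_of_le_smul_of_le_jacobson_bot (I := Ideal.span {(ℓ : R)})
      · exact Module.Finite.fg_top
      · rw [Ideal.span_singleton_le_iff_mem]; exact ell_jac ℓ
      · intro x _
        obtain ⟨v, hv⟩ := hσ (π x)
        have h3 : π (x - A v) = 0 := by rw [map_sub, hA', hv, sub_self]
        obtain ⟨y, hy⟩ := hπk _ h3
        have h4 : x = A v + (ℓ : R) • y := by rw [hy]; abel
        rw [h4]
        exact Submodule.add_mem_sup ⟨v, rfl⟩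
          (Submodule.smul_mem_smul (Ideal.mem_span_singleton_self _) Submodule.mem_top)
    have hAs := LinearMap.range_eq_top.1 hsurj
    have hAi : Function.Injective A :=
      OrzechProperty.injective_of_surjective_of_injective g A hg hAs
    refine ⟨ModuleCat.of R (Fin n → R), ModuleCat.of R (Fin n → R), K.subtype ∘ₗ A, g',
      inferInstanceAs (Module.Projective R (Fin n → R)),
      inferInstanceAs (Module.Projective R (Fin n → R)),
      K.injective_subtype.comp hAi, hg', ?_⟩
    rw [LinearMap.range_comp_of_range_eq_top _ hsurj, Submodule.range_subtype]

end P5d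

set_option linter.style.haveILetI false
set_option linter.unusedSectionVars false
open Filter Topology

section P5e

lemma roots_few (ℓ : ℕ) [Fact ℓ.Prime] (T D : ℕ) : ∃ k0, ∀ k ≥ k0, ∀ p : Polynomial ℤ_[ℓ],
    p.Monic → p.natDegree = D →
    Nat.card {t : Fin T // (ℓ : ℤ_[ℓ]) ^ k ∣ p.eval ((t : ℕ) : ℤ_[ℓ])} ≤ D := by
  classical
  let v : Fin T → ℚ_[ℓ] := fun t => ((t : ℕ) : ℚ_[ℓ])
  have hv : Function.Injective v := fun a b h => Fin.ext (by
    simpa [v] using h)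
  let w : Finset (Fin T) → Fin T → ℝ := fun S i => ‖(∏ j ∈ S.erase i, (v i - v j))‖⁻¹
  let B : ℝ := ∑ S : Finset (Fin T), ∑ i ∈ S, w S i
  have hw : ∀ S i, 0 ≤ w S i := fun S i => by positivity
  have hl : (1 : ℝ) < ℓ := by exact_mod_cast (Fact.out : ℓ.Prime).one_lt
  have h1 : Tendsto (fun k : ℕ => ((ℓ : ℝ)⁻¹) ^ k * B) atTop (𝓝 (0 * B)) :=
    (tendsto_pow_atTop_nhds_zero_of_lt_one (by positivity) (inv_lt_one_of_one_lt₀ hl)).mul_const B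
  rw [zero_mul] at h1
  obtain ⟨k0, hk0⟩ := eventually_atTop.1 (h1.eventually (gt_mem_nhds one_pos))
  refine ⟨k0, fun k hk p hp hD => ?_⟩
  by_contra hcon
  push Not at hcon
  rw [Nat.card_eq_fintype_card, Fintype.card_subtype] at hcon
  obtain ⟨S, hS, hSc⟩ := Finset.exists_subset_card_eq (Nat.succ_le_of_lt hcon)
  let p' : Polynomial ℚ_[ℓ] := p.map (algebraMap ℤ_[ℓ] ℚ_[ℓ])
  have hp' : p'.Monic := hp.map _
  have hd : p'.natDegree = D := by rw [hp.natDegree_map, hD]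
  have hL := Lagrange.leadingCoeff_eq_sum (s := S) (v := v) hv.injOn (P := p') (by
    rw [Polynomial.degree_eq_natDegree hp'.ne_zero, hd, hSc]; push_cast; rfl)
  rw [hp'.leadingCoeff] at hL
  have h2 : (1 : ℝ) ≤ ∑ i ∈ S, (ℓ : ℝ)⁻¹ ^ k * w S i := by
    calc (1 : ℝ) = ‖(1 : ℚ_[ℓ])‖ := by simp
      _ ≤ _ := by
        rw [hL]
        refine (norm_sum_le _ _).trans (Finset.sum_le_sum fun i hi => ?_)
        rw [norm_div, div_eq_mul_inv]
        apply mul_le_mul_of_nonneg_right _ (hw S i)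
        have hi' := (Finset.mem_filter.1 (hS hi)).2
        obtain ⟨c, hc⟩ := hi'
        have : p'.eval (v i) = ((p.eval ((i : ℕ) : ℤ_[ℓ]) : ℤ_[ℓ]) : ℚ_[ℓ]) := by
          have h4 : v i = algebraMap ℤ_[ℓ] ℚ_[ℓ] ((i : ℕ) : ℤ_[ℓ]) := by simp [v]
          rw [h4, Polynomial.eval_map_algebraMap, Polynomial.aeval_algebraMap_apply]
          simp
        rw [this, ← PadicInt.norm_def, hc, norm_mul, norm_pow, PadicInt.norm_p]
        exact mul_le_of_le_one_right (by positivity) (PadicInt.norm_le_one c)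
  have h3 : ∑ i ∈ S, w S i ≤ B :=
    Finset.single_le_sum (f := fun S => ∑ i ∈ S, w S i)
      (fun S _ => Finset.sum_nonneg fun i _ => hw S i) (Finset.mem_univ S)
  rw [← Finset.mul_sum] at h2
  have h4 := hk0 k hk
  have h5 : ((ℓ : ℝ)⁻¹) ^ k * ∑ i ∈ S, w S i ≤ ((ℓ : ℝ)⁻¹) ^ k * B :=
    mul_le_mul_of_nonneg_left h3 (by positivity)
  linarith

variable {R : Type} [CommRing R]
variable (ℓ : ℕ) [Fact ℓ.Prime] [Algebra ℤ_[ℓ] R] [Module.Finite ℤ_[ℓ] R] 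

lemma EE_poly (n : ℕ) : ∃ D : ℕ, ∀ (k : ℕ) (A : EE R ℓ n k →ₗ[R] EE R ℓ n k),
    ∃ p : Polynomial ℤ_[ℓ], p.Monic ∧ p.natDegree = D ∧ ∀ (t : ℕ) (x : EE R ℓ n k),
      algebraMap ℤ_[ℓ] R (p.eval (t : ℤ_[ℓ])) • x ∈ LinearMap.range (A - (t : R) • LinearMap.id) := by
  refine ⟨(⊤ : Submodule ℤ_[ℓ] (Fin n → R)).spanFinrank, fun k A => ?_⟩
  let π := Submodule.mkQ (elSub ((ℓ : R) ^ k) (Fin n → R))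
  obtain ⟨B, hB⟩ := Module.projective_lifting_property π (A ∘ₗ π) (Submodule.mkQ_surjective _)
  have hB' : ∀ x, π (B x) = A (π x) := fun x => LinearMap.congr_fun hB x
  let B0 : Module.End ℤ_[ℓ] (Fin n → R) := B.restrictScalars ℤ_[ℓ]
  obtain ⟨p, hp, hd, ha⟩ := LinearMap.exists_monic_and_natDegree_eq_and_aeval_eq_zero ℤ_[ℓ] B0
  refine ⟨p, hp, hd, fun t x => ?_⟩
  obtain ⟨x, rfl⟩ := Submodule.mkQ_surjective _ x
  obtain ⟨q, hq⟩ := Polynomial.X_sub_C_dvd_sub_C_eval (a := (t : ℤ_[ℓ])) (p := p)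
  have h1 := LinearMap.congr_fun (congrArg (Polynomial.aeval B0) hq) x
  rw [map_sub, ha, map_mul, map_sub, Polynomial.aeval_X, Polynomial.aeval_C, Polynomial.aeval_C] at h1
  let y := Polynomial.aeval B0 q x
  have h2 : - (algebraMap ℤ_[ℓ] R (p.eval (t : ℤ_[ℓ])) • x) = B y - (t : R) • y := by
    have h3 : - (p.eval (t : ℤ_[ℓ]) • x) = B y - (t : ℤ_[ℓ]) • y := by
      have h5 : (B0 - algebraMap ℤ_[ℓ] (Module.End ℤ_[ℓ] (Fin n → R)) (t : ℤ_[ℓ])) y =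
        B y - (t : ℤ_[ℓ]) • y := rfl
      rw [← h5]
      rw [zero_sub] at h1
      exact h1
    rw [algebraMap_smul R, h3, ← algebraMap_smul R (t : ℤ_[ℓ]) y, map_natCast]
  refine ⟨- π y, ?_⟩
  have h4 := congrArg (fun z => π (-z)) h2
  simp only [neg_neg] at h4
  change _ = π (algebraMap ℤ_[ℓ] R (p.eval (t : ℤ_[ℓ])) • x)
  rw [h4]
  simp only [map_neg, map_sub, map_smul, hB', LinearMap.sub_apply, LinearMap.smul_apply,
    LinearMap.id_apply]

/-- the bad set -/
abbrev Bad (R : Type) [CommRing R] (ℓ n k : ℕ) (A : EE R ℓ n (k + 1) →ₗ[R] EE R ℓ n (k + 1)) : Prop :=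
  ¬ ∀ x : EE R ℓ n (k + 1) ⧸ LinearMap.range A, (ℓ : R) ^ k • x = 0

lemma bad_dvd {n k : ℕ} (A : EE R ℓ n (k + 1) →ₗ[R] EE R ℓ n (k + 1)) (a : ℤ_[ℓ])
    (h : ∀ x : EE R ℓ n (k + 1), algebraMap ℤ_[ℓ] R a • x ∈ LinearMap.range A) (hb : Bad R ℓ n k A) :
    (ℓ : ℤ_[ℓ]) ^ (k + 1) ∣ a := by
  by_contra hd
  apply hb
  intro x
  obtain ⟨x, rfl⟩ := Submodule.mkQ_surjective _ x
  have ha : a ≠ 0 := by rintro rfl; simp at hd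
  have hs := PadicInt.unitCoeff_spec ha
  have hv : a.valuation ≤ k := by
    by_contra hv
    push Not at hv
    apply hd
    rw [hs]
    exact Dvd.dvd.mul_left (pow_dvd_pow _ hv) _
  have h1 := h (algebraMap ℤ_[ℓ] R (((PadicInt.unitCoeff ha)⁻¹ : ℤ_[ℓ]ˣ) * (ℓ : ℤ_[ℓ]) ^ (k - a.valuation)) • x)
  rw [smul_smul, ← map_mul] at h1
  have h2 : a * (((PadicInt.unitCoeff ha)⁻¹ : ℤ_[ℓ]ˣ) * (ℓ : ℤ_[ℓ]) ^ (k - a.valuation)) = (ℓ : ℤ_[ℓ]) ^ k := by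
    calc _ = ((PadicInt.unitCoeff ha : ℤ_[ℓ]) * (ℓ : ℤ_[ℓ]) ^ a.valuation) *
          (((PadicInt.unitCoeff ha)⁻¹ : ℤ_[ℓ]ˣ) * (ℓ : ℤ_[ℓ]) ^ (k - a.valuation)) := by
            rw [← hs]
      _ = _ := by
        rw [mul_mul_mul_comm, ← pow_add, Nat.add_sub_cancel' hv]
        simp
  rw [h2] at h1
  rw [← map_smul, Submodule.mkQ_apply, Submodule.Quotient.mk_eq_zero]
  simpa using h1

lemma bad_few (n : ℕ) (ε : ℝ) (hε : 0 < ε) : ∃ k0, ∀ k ≥ k0,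
    (Nat.card {A : EE R ℓ n (k + 1) →ₗ[R] EE R ℓ n (k + 1) // Bad R ℓ n k A} : ℝ) ≤
      ε * Nat.card (EE R ℓ n (k + 1) →ₗ[R] EE R ℓ n (k + 1)) := by
  obtain ⟨D, hD⟩ := EE_poly (R := R) ℓ n
  obtain ⟨T, hT⟩ := exists_nat_gt (D / ε)
  have hT0 : (0 : ℝ) < T := lt_of_le_of_lt (by positivity) hT
  obtain ⟨k0, hk0⟩ := roots_few ℓ T D
  refine ⟨k0, fun k hk => ?_⟩
  haveI : Finite (EE R ℓ n (k + 1)) := finite_quot ℓ _ _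
  have h1 : Nat.card {x : Fin T × (EE R ℓ n (k + 1) →ₗ[R] EE R ℓ n (k + 1)) //
      Bad R ℓ n k (x.2 - ((x.1 : ℕ) : R) • LinearMap.id)} =
      T * Nat.card {A : EE R ℓ n (k + 1) →ₗ[R] EE R ℓ n (k + 1) // Bad R ℓ n k A} := by
    have : T = Nat.card (Fin T) := by rw [Nat.card_eq_fintype_card, Fintype.card_fin]
    conv_rhs => rw [this]
    rw [← Nat.card_prod]
    refine Nat.card_congr ⟨fun x => (x.1.1, ⟨_, x.2⟩),
      fun y => ⟨(y.1, y.2.1 + ((y.1 : ℕ) : R) • LinearMap.id), ?_⟩, fun x => ?_, fun y => ?_⟩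
    · simpa using y.2.2
    · apply Subtype.ext; simp
    · apply Prod.ext
      · rfl
      · apply Subtype.ext; simp
  have h2 : Nat.card {x : Fin T × (EE R ℓ n (k + 1) →ₗ[R] EE R ℓ n (k + 1)) //
      Bad R ℓ n k (x.2 - ((x.1 : ℕ) : R) • LinearMap.id)} ≤
      Nat.card (EE R ℓ n (k + 1) →ₗ[R] EE R ℓ n (k + 1)) * D := by
    have e : {x : Fin T × (EE R ℓ n (k + 1) →ₗ[R] EE R ℓ n (k + 1)) //
      Bad R ℓ n k (x.2 - ((x.1 : ℕ) : R) • LinearMap.id)} ≃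
      Σ A : (EE R ℓ n (k + 1) →ₗ[R] EE R ℓ n (k + 1)), {t : Fin T //
        Bad R ℓ n k (A - ((t : ℕ) : R) • LinearMap.id)} :=
      ⟨fun x => ⟨x.1.2, ⟨x.1.1, x.2⟩⟩, fun y => ⟨(y.2.1, y.1), y.2.2⟩, fun _ => rfl, fun _ => rfl⟩
    rw [Nat.card_congr e, Nat.card_sigma]
    refine (Finset.sum_le_card_nsmul Finset.univ _ D ?_).trans ?_
    · intro A _
      obtain ⟨p, hp, hpd, h⟩ := hD (k + 1) A
      refine le_trans ?_ (hk0 (k + 1) (by omega) p hp hpd)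
      exact Nat.card_le_card_of_injective
        (fun t => ⟨t.1, bad_dvd ℓ _ _ (h t.1) t.2⟩) (fun a b h' => Subtype.ext (by simpa using h'))
    · rw [Finset.card_univ, smul_eq_mul, ← Nat.card_eq_fintype_card]
  rw [h1] at h2
  have h3 : (T : ℝ) * Nat.card {A : EE R ℓ n (k + 1) →ₗ[R] EE R ℓ n (k + 1) // Bad R ℓ n k A} ≤
      Nat.card (EE R ℓ n (k + 1) →ₗ[R] EE R ℓ n (k + 1)) * D := by exact_mod_cast h2
  rw [div_lt_iff₀ hε] at hT
  have h4 : (0 : ℝ) ≤ Nat.card (EE R ℓ n (k + 1) →ₗ[R] EE R ℓ n (k + 1)) := by positivity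
  rw [← mul_le_mul_iff_right₀ hT0]
  refine h3.trans ?_
  rw [← mul_assoc, mul_comm]
  exact mul_le_mul_of_nonneg_right hT.le h4

end P5e

set_option linter.style.haveILetI false
set_option linter.unusedSectionVars false
open Filter Topology

section P5f
variable {R : Type} [CommRing R]
variable (ℓ : ℕ) [Fact ℓ.Prime] [Algebra ℤ_[ℓ] R] [Module.Finite ℤ_[ℓ] R] [Module.Free ℤ_[ℓ] R]
  [Finite (MaximalSpectrum R)] [∀ j : MaximalSpectrum R, Finite (kk j)]

open Classical in
/-- the level `n` weight -/
noncomputable def aw (R : Type) [CommRing R] [Finite (MaximalSpectrum R)]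
    [∀ j : MaximalSpectrum R, Finite (kk j)] (n : ℕ) (M : Type) [AddCommGroup M] [Module R M] : ℝ :=
  (if HasProjDimLEOne R M then cm R n else 0) * UU R n M / numAut R M

lemma aw_nonneg (n : ℕ) (M : Type) [AddCommGroup M] [Module R M] [Finite M] : 0 ≤ aw R n M := by
  have := cm_pos (R := R) n
  have := UU_nonneg (R := R) (M := M) n
  unfold aw
  split_ifs <;> positivity

lemma aw_law {n k : ℕ} {M : Type} [AddCommGroup M] [Module R M] [Finite M]
    [Finite (EE R ℓ n (k + 1))]
    (hM : ∀ x : M, (ℓ : R) ^ k • x = 0) :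
    (Nat.card {A : EE R ℓ n (k + 1) →ₗ[R] EE R ℓ n (k + 1) //
      Nonempty ((EE R ℓ n (k + 1) ⧸ LinearMap.range A) ≃ₗ[R] M)} : ℝ) =
      aw R n M * Nat.card (EE R ℓ n (k + 1) →ₗ[R] EE R ℓ n (k + 1)) := by
  apply EE_law
  · intro x; rw [pow_succ', mul_smul, hM, smul_zero]
  · intro s
    have h := key_lemma ℓ hM s
    split_ifs with hp
    · exact h.1 hp
    · exact h.2 hp

lemma numSurj_quot_le {E M : Type} [AddCommGroup E] [Module R E] [Finite E]
    [AddCommGroup M] [Module R M] [Finite M] (N : Submodule R E) :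
    numSurj R (E ⧸ N) M ≤ numSurj R E M := by
  rw [card_surj_quot, numSurj]
  exact Nat.card_le_card_of_injective _ Subtype.val_injective

variable {ι : Type} {Mod : ι → ModuleCat.{0} R} [∀ i, Finite (Mod i)]

lemma level_sum (ℓ : ℕ) [Fact ℓ.Prime] [Algebra ℤ_[ℓ] R] [Module.Finite ℤ_[ℓ] R]
    [Module.Free ℤ_[ℓ] R]
    (hcomplete : ∀ (M : Type) [AddCommGroup M] [Module R M], Finite M → ∃ i, Nonempty (M ≃ₗ[R] Mod i))
    (hirr : ∀ i j, Nonempty ((Mod i : Type) ≃ₗ[R] Mod j) → i = j) (n : ℕ)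
    (M : Type) [AddCommGroup M] [Module R M] [Finite M] :
    HasSum (fun i => aw R n (Mod i) * (numSurj R (Mod i) M : ℝ)) (UU R n M) := by
  have hE : ∀ k, Finite (EE R ℓ n (k + 1)) := fun k => finite_quot ℓ _ _
  obtain ⟨kM, hkM⟩ := ell_kill (R := R) ℓ M
  -- class map
  have hcl : ∀ k, ∀ A : EE R ℓ n (k + 1) →ₗ[R] EE R ℓ n (k + 1),
      ∃ i, Nonempty ((EE R ℓ n (k + 1) ⧸ LinearMap.range A) ≃ₗ[R] Mod i) := fun k A =>
    hcomplete _ (Finite.of_surjective _ (Submodule.mkQ_surjective (LinearMap.range A)))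
  choose cl hcl using hcl
  have hcl' : ∀ k A i, Nonempty ((EE R ℓ n (k + 1) ⧸ LinearMap.range A) ≃ₗ[R] Mod i) ↔ cl k A = i := by
    intro k A i
    constructor
    · rintro ⟨e⟩
      obtain ⟨e'⟩ := hcl k A
      exact hirr _ _ ⟨e'.symm.trans e⟩
    · rintro rfl; exact hcl k A
  let G : ι → ℝ := fun i => (numSurj R (Mod i) M : ℝ)
  have hG : ∀ i, 0 ≤ G i := fun i => by positivity
  have hmom : ∀ k ≥ kM, ∑ A, G (cl k A) =
      UU R n M * Nat.card (EE R ℓ n (k + 1) →ₗ[R] EE R ℓ n (k + 1)) := by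
    intro k hk
    rw [← EE_moment (hkM (k + 1) (by omega))]
    apply Finset.sum_congr rfl
    intro A _
    obtain ⟨e⟩ := hcl k A
    simp only [G]
    rw [numSurj_congr_left e]
  have hpos : ∀ k, (0 : ℝ) < Nat.card (EE R ℓ n (k + 1) →ₗ[R] EE R ℓ n (k + 1)) :=
    fun k => cardpos _
  classical
  have hF : ∀ k, ∀ F : Finset ι, (∀ i ∈ F, ∀ x : Mod i, (ℓ : R) ^ k • x = 0) →
      (∑ i ∈ F, aw R n (Mod i) * G i) * Nat.card (EE R ℓ n (k + 1) →ₗ[R] EE R ℓ n (k + 1)) =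
        ∑ A ∈ Finset.univ.filter (fun A => cl k A ∈ F), G (cl k A) := by
    intro k F hk
    rw [Finset.sum_mul]
    rw [← Finset.sum_fiberwise_of_maps_to (s := Finset.univ.filter (fun A => cl k A ∈ F)) (t := F)
      (g := cl k) (fun A hA => (Finset.mem_filter.1 hA).2)]
    apply Finset.sum_congr rfl
    intro i hi
    have h1 : ∀ A ∈ (Finset.univ.filter (fun A => cl k A ∈ F)).filter (fun A => cl k A = i),
        G (cl k A) = G i := fun A hA => by rw [(Finset.mem_filter.1 hA).2]
    rw [Finset.sum_congr rfl h1, Finset.sum_const, nsmul_eq_mul]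
    have h2 := aw_law ℓ (n := n) (hk i hi)
    rw [mul_right_comm, ← h2]
    congr 2
    rw [Nat.card_eq_fintype_card, Fintype.card_subtype]
    congr 1
    ext A
    simp only [Finset.mem_filter, Finset.mem_univ, true_and, hcl']
    constructor
    · rintro rfl; exact ⟨hi, rfl⟩
    · exact fun h => h.2
  refine hasSum_of_isLUB_of_nonneg _ (fun i => mul_nonneg (aw_nonneg n _) (hG i)) ⟨?_, ?_⟩
  · rintro _ ⟨F, rfl⟩
    have : ∃ k ≥ kM, ∀ i ∈ F, ∀ x : Mod i, (ℓ : R) ^ k • x = 0 := by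
      choose κ hκ using fun i => ell_kill (R := R) ℓ (Mod i)
      refine ⟨kM + ∑ i ∈ F, κ i, by omega, fun i hi x => hκ i _ ?_ x⟩
      have := Finset.single_le_sum (f := κ) (fun i _ => Nat.zero_le _) hi
      omega
    obtain ⟨k, hk, hkF⟩ := this
    have h1 := hF k F hkF
    rw [← mul_le_mul_iff_left₀ (hpos k)]
    change (∑ i ∈ F, aw R n (Mod i) * G i) * _ ≤ _
    rw [h1, ← hmom k hk]
    exact Finset.sum_le_sum_of_subset_of_nonneg (Finset.filter_subset _ _) (fun A _ _ => hG _)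
  · intro b hb
    apply le_of_forall_pos_le_add
    intro ε hε
    let C : ℝ := numSurj R (Fin n → R) M
    have hC : 0 ≤ C := by positivity
    obtain ⟨k0, hk0⟩ := bad_few (R := R) ℓ n (ε / (C + 1)) (by positivity)
    let k := max k0 kM
    have hk := hk0 k (le_max_left _ _)
    let good : Finset (EE R ℓ n (k + 1) →ₗ[R] EE R ℓ n (k + 1)) :=
      Finset.univ.filter (fun A => ¬ Bad R ℓ n k A)
    let F : Finset ι := good.image (cl k)
    have hFk : ∀ i ∈ F, ∀ x : Mod i, (ℓ : R) ^ k • x = 0 := by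
      intro i hi x
      obtain ⟨A, hA, rfl⟩ := Finset.mem_image.1 hi
      have hA' := not_not.1 (Finset.mem_filter.1 hA).2
      obtain ⟨e⟩ := hcl k A
      obtain ⟨y, rfl⟩ := e.surjective x
      rw [← map_smul, hA', map_zero]
    have h1 := hF k F hFk
    have h2 := hmom k (le_max_right _ _)
    have h3 : ∑ A ∈ Finset.univ.filter (fun A => ¬ cl k A ∈ F), G (cl k A) ≤
        (Nat.card {A : EE R ℓ n (k + 1) →ₗ[R] EE R ℓ n (k + 1) // Bad R ℓ n k A} : ℝ) * C := by
      refine (Finset.sum_le_card_nsmul _ _ C ?_).trans ?_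
      · intro A _
        obtain ⟨e⟩ := hcl k A
        simp only [G, C]
        rw [← numSurj_congr_left e, ← EE_surj ℓ n (k + 1) M (hkM _ (by
          have := le_max_right k0 kM
          change kM ≤ max k0 kM + 1
          omega))]
        exact_mod_cast numSurj_quot_le _
      · rw [nsmul_eq_mul]
        apply mul_le_mul_of_nonneg_right _ hC
        rw [Nat.card_eq_fintype_card, Fintype.card_subtype]
        norm_cast
        apply Finset.card_le_card
        intro A hA
        rw [Finset.mem_filter] at hA ⊢
        refine ⟨hA.1, ?_⟩
        by_contra hb
        exact hA.2 (Finset.mem_image_of_mem _ (Finset.mem_filter.2 ⟨Finset.mem_univ _, not_not.2 hb⟩))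
    rw [← Finset.sum_filter_add_sum_filter_not Finset.univ (fun A => cl k A ∈ F), ← h1] at h2
    have h4 : ∑ i ∈ F, aw R n (Mod i) * G i ≤ b := hb ⟨F, rfl⟩
    have h5 : (Nat.card {A : EE R ℓ n (k + 1) →ₗ[R] EE R ℓ n (k + 1) // Bad R ℓ n k A} : ℝ) * C ≤
        ε * Nat.card (EE R ℓ n (k + 1) →ₗ[R] EE R ℓ n (k + 1)) := by
      have h6 : ε / (C + 1) * C ≤ ε := by
        rw [div_mul_eq_mul_div, div_le_iff₀ (by positivity)]
        nlinarith
      calc _ ≤ (ε / (C + 1) * Nat.card (EE R ℓ n (k + 1) →ₗ[R] EE R ℓ n (k + 1))) * C :=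
            mul_le_mul_of_nonneg_right hk hC
        _ = (ε / (C + 1) * C) * Nat.card (EE R ℓ n (k + 1) →ₗ[R] EE R ℓ n (k + 1)) := by ring
        _ ≤ _ := mul_le_mul_of_nonneg_right h6 (hpos k).le
    rw [← mul_le_mul_iff_left₀ (hpos k), ← h2, add_mul]
    have h7 := mul_le_mul_of_nonneg_right h4 (hpos k).le
    linarith

end P5f

set_option linter.style.haveILetI false
set_option linter.unusedSectionVars false
open Filter Topology

section P5g
variable {R : Type} [CommRing R]
  [Finite (MaximalSpectrum R)] [∀ j : MaximalSpectrum R, Finite (kk j)]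

lemma cm_le_one (m : ℕ) : cm R m ≤ 1 := by
  refine Finset.prod_le_one (fun j _ => Finset.prod_nonneg fun i _ => (cterm_pos j i).le)
    fun j _ => Finset.prod_le_one (fun i _ => (cterm_pos j i).le) fun i _ => ?_
  have : 0 ≤ 1 / (QQ j : ℝ) ^ ((i : ℕ) + 1) := by positivity
  linarith

lemma numAut_pos (M : Type) [AddCommGroup M] [Module R M] [Finite M] : (0 : ℝ) < numAut R M := by
  haveI : Finite (M ≃ₗ[R] M) := Finite.of_injective (fun e => (e : M → M)) DFunLike.coe_injective
  haveI : Nonempty (M ≃ₗ[R] M) := ⟨LinearEquiv.refl R M⟩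
  have : 0 < Nat.card (M ≃ₗ[R] M) := Nat.card_pos
  exact_mod_cast this

open Classical in
/-- the limiting weight -/
noncomputable def mu (R : Type) [CommRing R] (M : Type) [AddCommGroup M] [Module R M] : ℝ :=
  if HasProjDimLEOne R M then cProd R / numAut R M else 0

lemma mu_nonneg (M : Type) [AddCommGroup M] [Module R M] [Finite M] : 0 ≤ mu R M := by
  have := cProd_pos (R := R)
  have := numAut_pos (R := R) M
  unfold mu
  split_ifs <;> positivity

lemma aw_tendsto (M : Type) [AddCommGroup M] [Module R M] [Finite M] :
    Tendsto (fun n => aw R n M) atTop (𝓝 (mu R M)) := by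
  unfold aw mu
  split_ifs
  · simpa using (cm_tendsto.mul (UU_tendsto (R := R) (M := M))).div_const (numAut R M : ℝ)
  · simp

lemma aw_le (n : ℕ) (M : Type) [AddCommGroup M] [Module R M] [Finite M] :
    aw R n M ≤ (cProd R)⁻¹ * mu R M := by
  have hc := cProd_pos (R := R)
  have ha := numAut_pos (R := R) M
  unfold aw mu
  split_ifs
  · rw [← mul_div_assoc, inv_mul_cancel₀ hc.ne']
    gcongr
    exact mul_le_one₀ (cm_le_one n) (UU_nonneg n) (UU_le_one n)
  · simp

variable {ι : Type} {Mod : ι → ModuleCat.{0} R} [∀ i, Finite (Mod i)]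

lemma mu_sum (ℓ : ℕ) [Fact ℓ.Prime] [Algebra ℤ_[ℓ] R] [Module.Finite ℤ_[ℓ] R]
    [Module.Free ℤ_[ℓ] R]
    (hcomplete : ∀ (M : Type) [AddCommGroup M] [Module R M], Finite M → ∃ i, Nonempty (M ≃ₗ[R] Mod i))
    (hirr : ∀ i j, Nonempty ((Mod i : Type) ≃ₗ[R] Mod j) → i = j)
    (M : Type) [AddCommGroup M] [Module R M] [Finite M] :
    HasSum (fun i => mu R (Mod i) * (numSurj R (Mod i) M : ℝ)) 1 := by
  have hl := fun n => level_sum ℓ hcomplete hirr n M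
  have hg : ∀ i, (0 : ℝ) ≤ numSurj R (Mod i) M := fun i => by positivity
  have ht : ∀ i, Tendsto (fun n => aw R n (Mod i) * (numSurj R (Mod i) M : ℝ)) atTop
      (𝓝 (mu R (Mod i) * (numSurj R (Mod i) M : ℝ))) := fun i => (aw_tendsto _).mul_const _
  have hs : Summable (fun i => mu R (Mod i) * (numSurj R (Mod i) M : ℝ)) := by
    refine summable_of_sum_le (c := 1) (fun i => mul_nonneg (mu_nonneg _) (hg i)) fun F => ?_
    refine le_of_tendsto' (tendsto_finsetSum F fun i _ => ht i) fun n => ?_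
    exact (sum_le_hasSum F (fun i _ => mul_nonneg (aw_nonneg n _) (hg i)) (hl n)).trans (UU_le_one n)
  have hd := tendsto_tsum_of_dominated_convergence
    (bound := fun i => (cProd R)⁻¹ * (mu R (Mod i) * (numSurj R (Mod i) M : ℝ)))
    (hs.mul_left _) ht (Eventually.of_forall fun n i => by
      rw [Real.norm_of_nonneg (mul_nonneg (aw_nonneg n _) (hg i)), ← mul_assoc]
      exact mul_le_mul_of_nonneg_right (aw_le n _) (hg i))
  simp_rw [fun n => (hl n).tsum_eq] at hd
  rw [← tendsto_nhds_unique hd (UU_tendsto (R := R) (M := M))]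
  exact hs.hasSum

lemma mu_CL (ℓ : ℕ) [Fact ℓ.Prime] [Algebra ℤ_[ℓ] R] [Module.Finite ℤ_[ℓ] R]
    [Module.Free ℤ_[ℓ] R]
    (hcomplete : ∀ (M : Type) [AddCommGroup M] [Module R M], Finite M → ∃ i, Nonempty (M ≃ₗ[R] Mod i))
    (hirr : ∀ i j, Nonempty ((Mod i : Type) ≃ₗ[R] Mod j) → i = j) :
    IsCLMeasure R ι Mod (fun i => mu R (Mod i)) := by
  refine ⟨fun i => mu_nonneg _, ?_, fun M _ _ hM => mu_sum ℓ hcomplete hirr M⟩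
  have h := mu_sum ℓ hcomplete hirr PUnit
  have h1 : ∀ i, numSurj R (Mod i) PUnit = 1 := by
    intro i
    haveI : Unique {f : (Mod i : Type) →ₗ[R] PUnit // Function.Surjective f} :=
      ⟨⟨⟨0, fun x => ⟨0, Subsingleton.elim _ _⟩⟩⟩, fun f => Subtype.ext (LinearMap.ext fun x => Subsingleton.elim _ _)⟩
    exact Nat.card_unique
  simpa [h1] using h

theorem main_gen (ℓ : ℕ) [Fact ℓ.Prime] (R : Type) [CommRing R] [Algebra ℤ_[ℓ] R]
    [Module.Finite ℤ_[ℓ] R] [Module.Free ℤ_[ℓ] R]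
    (ι : Type) (Mod : ι → ModuleCat.{0} R) (hfin : ∀ i, Finite (Mod i))
    (hcomplete : ∀ (M : Type) [AddCommGroup M] [Module R M], Finite M → ∃ i, Nonempty (M ≃ₗ[R] Mod i))
    (hirr : ∀ i j, Nonempty ((Mod i : Type) ≃ₗ[R] Mod j) → i = j) :
    ∃ μ : ι → ℝ, IsCLMeasure R ι Mod μ ∧ (∀ ν : ι → ℝ, IsCLMeasure R ι Mod ν → ν = μ) ∧
      (∀ i, (μ i ≠ 0 ↔ HasProjDimLEOne R (Mod i)) ∧
        (HasProjDimLEOne R (Mod i) → μ i = cProd R / (numAut R (Mod i) : ℝ))) := by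
  haveI := noeth (R := R) ℓ
  haveI := finite_maxspec (R := R) ℓ
  haveI : ∀ j : MaximalSpectrum R, Finite (kk j) := fun j => finite_residue ℓ j.asIdeal
  have h := mu_CL (R := R) (Mod := Mod) ℓ hcomplete hirr
  refine ⟨_, h, fun ν hν => uniq hirr hν h, fun i => ⟨?_, fun hp => if_pos hp⟩⟩
  have hc := cProd_pos (R := R)
  have ha := numAut_pos (R := R) (Mod i)
  constructor
  · intro hne
    by_contra hp
    exact hne (if_neg hp)
  · intro hp
    have : mu R (Mod i) = cProd R / numAut R (Mod i) := if_pos hp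
    simp only [this]
    positivity

end P5g

theorem statement17 (ℓ : ℕ) [Fact ℓ.Prime] (hodd : ℓ ≠ 2)
    (q : ℕ) (hq : ∃ r k : ℕ, r.Prime ∧ 0 < k ∧ q = r ^ k)
    (P : Polynomial ℤ_[ℓ]) (hP : P.Monic)
    (hPq : ¬ ((ℓ : ℤ_[ℓ]) ∣ Polynomial.eval (q : ℤ_[ℓ]) P))
    -- `Mod : ι → ModuleCat R` is a complete irredundant family of representatives of the
    -- isomorphism classes of all finite modules over `R = ℤ_ℓ[x]/(P)`:
    (ι : Type) (Mod : ι → ModuleCat.{0} (Polynomial ℤ_[ℓ] ⧸ Ideal.span {P}))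
    (hfin : ∀ i, Finite (Mod i))
    (hcomplete : ∀ (M : Type) [AddCommGroup M] [Module (Polynomial ℤ_[ℓ] ⧸ Ideal.span {P}) M],
      Finite M → ∃ i, Nonempty (M ≃ₗ[Polynomial ℤ_[ℓ] ⧸ Ideal.span {P}] Mod i))
    (hirr : ∀ i j, Nonempty ((Mod i : Type) ≃ₗ[Polynomial ℤ_[ℓ] ⧸ Ideal.span {P}] Mod j) →
      i = j) :
    ∃ μ : ι → ℝ,
      IsCLMeasure (Polynomial ℤ_[ℓ] ⧸ Ideal.span {P}) ι Mod μ ∧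
      (∀ ν : ι → ℝ, IsCLMeasure (Polynomial ℤ_[ℓ] ⧸ Ideal.span {P}) ι Mod ν → ν = μ) ∧
      (∀ i, (μ i ≠ 0 ↔ HasProjDimLEOne (Polynomial ℤ_[ℓ] ⧸ Ideal.span {P}) (Mod i)) ∧
        (HasProjDimLEOne (Polynomial ℤ_[ℓ] ⧸ Ideal.span {P}) (Mod i) →
          μ i = cProd (Polynomial ℤ_[ℓ] ⧸ Ideal.span {P}) /
            (numAut (Polynomial ℤ_[ℓ] ⧸ Ideal.span {P}) (Mod i) : ℝ))) := by
  haveI := hP.free_quotient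
  haveI := hP.finite_quotient
  exact main_gen ℓ _ ι Mod hfin hcomplete hirr
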